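/- Let B be a fragment of a fullerene graph F and let W be the set of all 2-degree vertices of B, with 0 < |W| ≤ 4. Then T := F − (V(B) ∖ W) is a forest; moreover (1) T is isomorphic to K_2 if |W| = 2; (2) T is isomorphic to K_{1,3} if |W| = 3; (3) T is the disjoint union of two copies of K_2, or a path of length 3, or the tree T_0 on six vertices consisting of two adjacent 3-degree vertices each also adjacent to two leaves, if |W| = 4. -/

import Mathlib

namespace FG

/-- A combinatorial plane (spherically embedded) graph: a finite simple graph together with
its collection of faces, each face recorded as the finset of edges of its boundary cycle.
Every face boundary is a cycle, every edge lies on exactly two faces, and Euler's formula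
holds (edges are counted via the face incidences). -/
structure PlaneGraph (V : Type) [Fintype V] [DecidableEq V] : Type where
  graph : SimpleGraph V
  faces : Finset (Finset (Sym2 V))
  face_edges : ∀ f ∈ faces, ∀ e ∈ f, e ∈ graph.edgeSet
  face_cycle : ∀ f ∈ faces, ∃ (v : V) (c : graph.Walk v v), c.IsCycle ∧ c.edges.toFinset = f
  edge_faces : ∀ e ∈ graph.edgeSet, (faces.filter (fun f => e ∈ f)).card = 2
  euler : 2 * (Fintype.card V + faces.card) = (∑ f ∈ faces, f.card) + 4

variable {V : Type} [Fintype V] [DecidableEq V]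

/-- The vertices incident with at least one edge of an edge set. -/
def edgeVerts (E : Finset (Sym2 V)) : Finset V :=
  Finset.univ.filter fun v => ∃ e ∈ E, v ∈ e

/-- The degree of a vertex in the subgraph spanned by an edge set. -/
def deg (E : Finset (Sym2 V)) (v : V) : ℕ := (E.filter fun e => v ∈ e).card

/-- The vertices covered by a collection of faces. -/
def facesVerts (H : Finset (Finset (Sym2 V))) : Finset V := edgeVerts (H.sup id)

/-- An edge set is a matching: non-loop edges, pairwise vertex-disjoint. -/
def IsMatching (M : Finset (Sym2 V)) : Prop :=
  (∀ e ∈ M, ¬e.IsDiag) ∧ ∀ e ∈ M, ∀ e' ∈ M, e ≠ e' → ∀ v : V, v ∈ e → v ∉ e'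

/-- A fullerene graph: a cubic 3-connected plane graph with (exactly 12) pentagonal
faces and hexagonal faces. -/
structure IsFullerene (P : PlaneGraph V) : Prop where
  cubic : ∀ v : V, (P.graph.neighborSet v).ncard = 3
  threeConnected : ∀ s : Set V, s.ncard ≤ 2 → (SimpleGraph.induce sᶜ P.graph).Connected
  faceSize : ∀ f ∈ P.faces, f.card = 5 ∨ f.card = 6
  pentTwelve : (P.faces.filter fun f => f.card = 5).card = 12

/-- A fragment of a plane graph: a nonempty set of faces (a cycle together with its
interior) whose boundary — the set of edges lying on exactly one chosen face — is a
single cycle. -/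
structure Fragment (P : PlaneGraph V) : Type where
  inFaces : Finset (Finset (Sym2 V))
  nonempty : inFaces.Nonempty
  subFaces : inFaces ⊆ P.faces
  boundary_cycle : ∃ (v : V) (c : P.graph.Walk v v), c.IsCycle ∧
    c.edges.toFinset =
      (inFaces.sup id).filter fun e => (inFaces.filter fun f => e ∈ f).card = 1

/-- The edge set of a fragment. -/
def Fragment.edges {P : PlaneGraph V} (B : Fragment P) : Finset (Sym2 V) := B.inFaces.sup id

/-- The boundary edges of a fragment. -/
def Fragment.boundary {P : PlaneGraph V} (B : Fragment P) : Finset (Sym2 V) :=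
  B.edges.filter fun e => (B.inFaces.filter fun f => e ∈ f).card = 1

/-- A pentagonal fragment: all inner faces are pentagons. -/
def IsPentagonalFragment {P : PlaneGraph V} (B : Fragment P) : Prop :=
  ∀ f ∈ B.inFaces, f.card = 5

/-- The faces of `P` adjoining the subgraph with edge set `E`: not a face of the
subgraph, but sharing at least one edge with it. -/
def adjoiningFaces (P : PlaneGraph V) (E : Finset (Sym2 V)) : Finset (Finset (Sym2 V)) :=
  P.faces.filter fun f => ¬f ⊆ E ∧ (f ∩ E).Nonempty

/-- The territory `T[G]` of the subgraph with edge set `E`: the subgraph together with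
all adjoining faces. -/
def territoryEdges (P : PlaneGraph V) (E : Finset (Sym2 V)) : Finset (Sym2 V) :=
  E ∪ (adjoiningFaces P E).sup id

/-- `w(G)`: the number of 2-degree vertices of the subgraph spanned by `E`. -/
def wcount (E : Finset (Sym2 V)) : ℕ := ((edgeVerts E).filter fun v => deg E v = 2).card

/-- A subgraph is maximal in `P` when its hexagon extension is contained in `P`,
i.e. every adjoining face is a hexagon. -/
def IsMaximalIn (P : PlaneGraph V) (E : Finset (Sym2 V)) : Prop :=
  ∀ f ∈ adjoiningFaces P E, f.card = 6

/-- `H ∈ 𝒮(G)` for the subgraph `G` with edge set `E`: `H` is a set of mutually disjoint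
hexagons of the hexagon extension `H[G]` (hexagonal faces sharing at least one edge with
`G`) such that `G − H` has a matching covering all remaining 3-degree vertices of `G`. -/
def SextetAdm (P : PlaneGraph V) (E : Finset (Sym2 V)) (H : Finset (Finset (Sym2 V))) : Prop :=
  (∀ f ∈ H, f ∈ P.faces ∧ f.card = 6 ∧ (f ∩ E).Nonempty) ∧
  (∀ f ∈ H, ∀ g ∈ H, f ≠ g → Disjoint (edgeVerts f) (edgeVerts g)) ∧
  ∃ M : Finset (Sym2 V), M ⊆ E ∧ IsMatching M ∧
    (∀ e ∈ M, ∀ v : V, v ∈ e → v ∉ facesVerts H) ∧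
    ∀ v ∈ edgeVerts E, deg E v = 3 → v ∉ facesVerts H → ∃ e ∈ M, v ∈ e

/-- `U_H(G) = V(G) ∖ V(H)`. -/
def Uset (E : Finset (Sym2 V)) (H : Finset (Finset (Sym2 V))) : Finset V :=
  edgeVerts E \ facesVerts H

/-- A Clar set of `H[G]`: a member of `𝒮(G)` minimizing `|U_H(G)|`. -/
def IsClarSet (P : PlaneGraph V) (E : Finset (Sym2 V)) (H : Finset (Finset (Sym2 V))) : Prop :=
  SextetAdm P E H ∧ ∀ H', SextetAdm P E H' → (Uset E H).card ≤ (Uset E H').card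

/-- A normal Clar set: a Clar set such that `G − H` has a perfect matching. -/
def IsNormalClarSet (P : PlaneGraph V) (E : Finset (Sym2 V))
    (H : Finset (Finset (Sym2 V))) : Prop :=
  IsClarSet P E H ∧ ∃ M : Finset (Sym2 V), M ⊆ E ∧ IsMatching M ∧
    (∀ e ∈ M, ∀ v : V, v ∈ e → v ∉ facesVerts H) ∧
    ∀ v ∈ Uset E H, ∃ e ∈ M, v ∈ e

/-- The pentagonal faces of the subgraph with edge set `E`. -/
def pentFaces (P : PlaneGraph V) (E : Finset (Sym2 V)) : Finset (Finset (Sym2 V)) :=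
  P.faces.filter fun f => f.card = 5 ∧ f ⊆ E

/-- A subgraph with `k` pentagons is extremal if `|U_H(G)| = k` for a Clar set `H`. -/
def IsExtremalSub (P : PlaneGraph V) (E : Finset (Sym2 V)) : Prop :=
  ∃ H, IsClarSet P E H ∧ (Uset E H).card = (pentFaces P E).card

/-- A pentagonal ring `R_k`: `k` pentagonal faces `R 0, …, R (k-1)` such that
`R i` and `R j` intersect iff `|i − j| = 1 (mod k)`. -/
def IsPentRing (P : PlaneGraph V) (k : ℕ) (R : ZMod k → Finset (Sym2 V)) : Prop :=
  Function.Injective R ∧ (∀ i, R i ∈ P.faces ∧ (R i).card = 5) ∧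
  ∀ i j : ZMod k, i ≠ j →
    ((edgeVerts (R i) ∩ edgeVerts (R j)).Nonempty ↔ (j = i + 1 ∨ i = j + 1))

/-- The number of pentagons of the pentagonal fragment `B` adjoining (sharing an edge
with) the pentagon `p`. -/
def pentAdjCount {P : PlaneGraph V} (B : Fragment P) (p : Finset (Sym2 V)) : ℕ :=
  (B.inFaces.filter fun q => q ≠ p ∧ (q ∩ p).Nonempty).card

/-- The fragment consisting of a single pentagon `P`. -/
def IsPentagonFrag {P : PlaneGraph V} (B : Fragment P) : Prop :=
  IsPentagonalFragment B ∧ B.inFaces.card = 1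

/-- `B_2`: the extremal pentagonal fragment with 4 pentagons whose Clar extension is
normal. -/
def IsB2Frag {P : PlaneGraph V} (B : Fragment P) : Prop :=
  IsPentagonalFragment B ∧ B.inFaces.card = 4 ∧ IsExtremalSub P B.edges ∧
    ∃ H, IsNormalClarSet P B.edges H

/-- `B_3`: the extremal pentagonal fragment with 6 pentagons whose Clar extension is
normal. -/
def IsB3Frag {P : PlaneGraph V} (B : Fragment P) : Prop :=
  IsPentagonalFragment B ∧ B.inFaces.card = 6 ∧ IsExtremalSub P B.edges ∧
    ∃ H, IsNormalClarSet P B.edges H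

/-- A pasting edge of the subgraph with edge set `E`: an edge of `E` lying on the
boundary of the Clar extension `C[G]` (not an edge of a Clar hexagon) whose two
end-vertices belong to `V(H)` for a Clar set `H`. -/
def IsPastingEdge (P : PlaneGraph V) (E : Finset (Sym2 V)) (e : Sym2 V) : Prop :=
  e ∈ E ∧ ∃ H, IsClarSet P E H ∧ (∀ v : V, v ∈ e → v ∈ facesVerts H) ∧ e ∉ H.sup id

/-- `B` arises from pasting `A` and `C` along a common pasting edge:
`B = A ∪ C` and `A ∩ C` is a single pasting edge of both. -/
def IsPasting {P : PlaneGraph V} (B A C : Fragment P) : Prop :=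
  B.inFaces = A.inFaces ∪ C.inFaces ∧
  ∃ e : Sym2 V, A.edges ∩ C.edges = {e} ∧ IsPastingEdge P A.edges e ∧ IsPastingEdge P C.edges e

def IsBasicFrag {P : PlaneGraph V} (B : Fragment P) : Prop :=
  IsPentagonFrag B ∨ IsB2Frag B ∨ IsB3Frag B

/-- The pentagonal fragments generated from `P`, `B_2`, `B_3` by the pasting operation. -/
inductive Pasted (P : PlaneGraph V) : Fragment P → Prop
  | base (B : Fragment P) : IsBasicFrag B → Pasted P B
  | paste (B A C : Fragment P) : Pasted P A → IsBasicFrag C → IsPasting B A C → Pasted P B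

/-- `P ∗ P`. -/
def IsPPFrag {P : PlaneGraph V} (B : Fragment P) : Prop :=
  ∃ A C : Fragment P, IsPentagonFrag A ∧ IsPentagonFrag C ∧ IsPasting B A C

/-- `P ∗ B_2`. -/
def IsPB2Frag {P : PlaneGraph V} (B : Fragment P) : Prop :=
  ∃ A C : Fragment P, IsPentagonFrag A ∧ IsB2Frag C ∧ IsPasting B A C

/-- `P ∗ B_2 ∗ P`. -/
def IsPB2PFrag {P : PlaneGraph V} (B : Fragment P) : Prop :=
  ∃ B' A C D : Fragment P, IsPentagonFrag A ∧ IsB2Frag C ∧ IsPentagonFrag D ∧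
    IsPasting B' A C ∧ IsPasting B B' D

/-- The six members of `𝓑_{≥60}`. -/
def SixShapes {P : PlaneGraph V} (B : Fragment P) : Prop :=
  IsPentagonFrag B ∨ IsB2Frag B ∨ IsB3Frag B ∨ IsPPFrag B ∨ IsPB2Frag B ∨ IsPB2PFrag B

/-- `B_1`: two vertex-disjoint pentagons joined by an edge. -/
def IsB1 (P : PlaneGraph V) (E : Finset (Sym2 V)) : Prop :=
  ∃ (f g : Finset (Sym2 V)) (a b : V), f ∈ P.faces ∧ g ∈ P.faces ∧ f.card = 5 ∧ g.card = 5 ∧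
    Disjoint (edgeVerts f) (edgeVerts g) ∧ P.graph.Adj a b ∧
    a ∈ edgeVerts f ∧ b ∈ edgeVerts g ∧ E = f ∪ g ∪ {s(a, b)}

/-- `B_1^k`: `k` copies of `B_1` pasted together along pasting edges of their pentagons. -/
inductive B1Pow (P : PlaneGraph V) : ℕ → Finset (Sym2 V) → Prop
  | one (E : Finset (Sym2 V)) : IsB1 P E → B1Pow P 1 E
  | succ (k : ℕ) (E X : Finset (Sym2 V)) (e : Sym2 V) (f g : Finset (Sym2 V)) :
      B1Pow P k E → IsB1 P X → E ∩ X = {e} → f ∈ P.faces → g ∈ P.faces →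
      f.card = 5 → g.card = 5 → f ⊆ E → g ⊆ X → e ∈ f → e ∈ g →
      IsPastingEdge P f e → IsPastingEdge P g e → B1Pow P (k + 1) (E ∪ X)

/-- `F` contains `B_1^k` for some `2 ≤ k ≤ 4` as a subgraph. -/
def ContainsB1Pow (P : PlaneGraph V) : Prop :=
  ∃ (k : ℕ) (E : Finset (Sym2 V)), 2 ≤ k ∧ k ≤ 4 ∧ B1Pow P k E

/-- A perfect matching of the plane graph `P`. -/
def IsPerfectMatching (P : PlaneGraph V) (M : Finset (Sym2 V)) : Prop :=
  (∀ e ∈ M, e ∈ P.graph.edgeSet) ∧ IsMatching M ∧ ∀ v : V, ∃ e ∈ M, v ∈ e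

/-- A sextet pattern of `P`: mutually disjoint hexagonal faces, all alternating with
respect to a common perfect matching. -/
def IsSextetPattern (P : PlaneGraph V) (H : Finset (Finset (Sym2 V))) : Prop :=
  (∀ f ∈ H, f ∈ P.faces ∧ f.card = 6) ∧
  (∀ f ∈ H, ∀ g ∈ H, f ≠ g → Disjoint (edgeVerts f) (edgeVerts g)) ∧
  ∃ M : Finset (Sym2 V), IsPerfectMatching P M ∧ ∀ f ∈ H, (f ∩ M).card = 3

/-- A Clar formula: a maximum sextet pattern. -/
def IsClarFormula (P : PlaneGraph V) (H : Finset (Finset (Sym2 V))) : Prop :=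
  IsSextetPattern P H ∧ ∀ H', IsSextetPattern P H' → H'.card ≤ H.card

/-- An extremal fullerene graph: the Clar number equals `(n − 12)/6`. -/
def IsExtremalFullerene (P : PlaneGraph V) : Prop :=
  ∃ H, IsClarFormula P H ∧ 6 * H.card = Fintype.card V - 12

/-- The edges of the union of all maximal pentagonal fragments of `P`. -/
noncomputable def maxPentEdges (P : PlaneGraph V) : Finset (Sym2 V) :=
  @Finset.filter _
    (fun e => ∃ B : Fragment P, IsPentagonalFragment B ∧ IsMaximalIn P B.edges ∧ e ∈ B.edges)
    (Classical.decPred _) (P.faces.sup id)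

/-- The disjoint union of two copies of `K_2`. -/
def twoK2 : SimpleGraph (Fin 4) := SimpleGraph.fromEdgeSet {s(0, 1), s(2, 3)}

/-- The tree `T_0` on six vertices: two adjacent 3-degree vertices, each also adjacent
to two leaves. -/
def treeT0 : SimpleGraph (Fin 6) :=
  SimpleGraph.fromEdgeSet {s(0, 1), s(0, 2), s(0, 3), s(1, 4), s(1, 5)}




/-! ### Basic counting -/

open Classical in
/-- all edges -/
noncomputable def ed (P : PlaneGraph V) : Finset (Sym2 V) :=
  Finset.univ.filter fun e => e ∈ P.graph.edgeSet

open Classical in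
/-- edges with both ends in `X` -/
noncomputable def EIn (P : PlaneGraph V) (X : Finset V) : Finset (Sym2 V) :=
  (ed P).filter fun e => ∀ v ∈ e, v ∈ X

open Classical in
/-- edges with exactly one end in `X` -/
noncomputable def cut (P : PlaneGraph V) (X : Finset V) : Finset (Sym2 V) :=
  (ed P).filter fun e => (∃ v ∈ e, v ∈ X) ∧ ∃ v ∈ e, v ∉ X

theorem mem_ed {P : PlaneGraph V} {e : Sym2 V} : e ∈ ed P ↔ e ∈ P.graph.edgeSet := by
  simp [ed]

theorem mem_EIn {P : PlaneGraph V} {X : Finset V} {e : Sym2 V} :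
    e ∈ EIn P X ↔ e ∈ ed P ∧ ∀ v ∈ e, v ∈ X := by
  simp [EIn]

theorem mem_cut {P : PlaneGraph V} {X : Finset V} {e : Sym2 V} :
    e ∈ cut P X ↔ e ∈ ed P ∧ (∃ v ∈ e, v ∈ X) ∧ ∃ v ∈ e, v ∉ X := by
  simp [cut]

theorem cut_compl (P : PlaneGraph V) (X : Finset V) : cut P Xᶜ = cut P X := by
  ext e
  simp only [mem_cut, Finset.mem_compl, not_not]
  tauto

theorem EIn_sub (P : PlaneGraph V) (X : Finset V) : EIn P X ⊆ ed P :=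
  fun _ h => (mem_EIn.1 h).1

theorem cut_sub (P : PlaneGraph V) (X : Finset V) : cut P X ⊆ ed P :=
  fun _ h => (mem_cut.1 h).1

theorem face_sub (P : PlaneGraph V) {f : Finset (Sym2 V)} (hf : f ∈ P.faces) : f ⊆ ed P :=
  fun e he => mem_ed.2 (P.face_edges f hf e he)

theorem ends_count (P : PlaneGraph V) (X : Finset V) {e : Sym2 V} (he : e ∈ ed P) :
    (X.filter fun v => v ∈ e).card =
      2 * (if e ∈ EIn P X then 1 else 0) + (if e ∈ cut P X then 1 else 0) := by
  induction e using Sym2.ind with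
  | _ a b =>
  have hab : a ≠ b := (mem_ed.1 he : P.graph.Adj a b).ne
  simp only [mem_EIn, mem_cut, he, true_and, Sym2.mem_iff]
  by_cases ha : a ∈ X <;> by_cases hb : b ∈ X
  · have : (X.filter fun v => v = a ∨ v = b) = {a, b} := by ext v; simp; aesop
    rw [this, Finset.card_pair hab]; simp [ha, hb]
  · have : (X.filter fun v => v = a ∨ v = b) = {a} := by ext v; simp; aesop
    rw [this]; simp [ha, hb]
  · have : (X.filter fun v => v = a ∨ v = b) = {b} := by ext v; simp; aesop
    rw [this]; simp [ha, hb]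
  · have : (X.filter fun v => v = a ∨ v = b) = ∅ := by ext v; simp; aesop
    rw [this]; simp [ha, hb]

theorem sum_deg (P : PlaneGraph V) (X : Finset V) {A : Finset (Sym2 V)} (hA : A ⊆ ed P) :
    ∑ v ∈ X, deg A v = 2 * (A ∩ EIn P X).card + (A ∩ cut P X).card := by
  have h1 : ∑ v ∈ X, deg A v = ∑ e ∈ A, (X.filter fun v => v ∈ e).card := by
    have := Finset.sum_card_bipartiteAbove_eq_sum_card_bipartiteBelow
      (s := X) (t := A) (fun (v : V) (e : Sym2 V) => v ∈ e)
    simpa [Finset.bipartiteAbove, Finset.bipartiteBelow, deg] using this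
  rw [h1, Finset.sum_congr rfl (fun e he => ends_count P X (hA he)), Finset.sum_add_distrib,
    ← Finset.mul_sum]
  simp [Finset.sum_ite_mem]

theorem deg_eq_ncard (P : PlaneGraph V) {A : Finset (Sym2 V)} (v : V) :
    deg A v = {w | s(v, w) ∈ A}.ncard := by
  classical
  rw [deg, Set.ncard_eq_toFinset_card']
  symm
  apply Finset.card_bij (fun w _ => s(v, w))
  · intro w hw; simpa using hw
  · intro a _ b _ h; exact Sym2.congr_right.1 h
  · intro e he
    obtain ⟨he, w, rfl⟩ := (by simpa using he : e ∈ A ∧ v ∈ e)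
    exact ⟨w, by simpa using he, rfl⟩

theorem deg_ed {P : PlaneGraph V} (hP : IsFullerene P) (v : V) : deg (ed P) v = 3 := by
  rw [deg_eq_ncard P, ← hP.cubic v]
  congr 1; ext w; simp [mem_ed]

theorem mem_edgeVerts {E : Finset (Sym2 V)} {v : V} : v ∈ edgeVerts E ↔ ∃ e ∈ E, v ∈ e := by
  simp [edgeVerts]

theorem deg_pos {E : Finset (Sym2 V)} {v : V} : 0 < deg E v ↔ v ∈ edgeVerts E := by
  rw [mem_edgeVerts, deg, Finset.card_pos]
  simp [Finset.Nonempty]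

theorem deg_face {P : PlaneGraph V} {f : Finset (Sym2 V)} (hf : f ∈ P.faces) {v : V}
    (hv : v ∈ edgeVerts f) : deg f v = 2 := by
  obtain ⟨u, c, hc, hcf⟩ := P.face_cycle f hf
  obtain ⟨e, he, hve⟩ := mem_edgeVerts.1 hv
  have hmem : v ∈ c.support := by
    rw [← hcf] at he
    obtain ⟨w, rfl⟩ := hve
    exact c.fst_mem_support_of_mem_edges (by simpa using he)
  rw [deg_eq_ncard P, ← hc.ncard_neighborSet_toSubgraph_eq_two hmem]
  congr 1; ext w
  rw [← hcf]
  simp [SimpleGraph.Subgraph.mem_neighborSet, SimpleGraph.Walk.adj_toSubgraph_iff_mem_edges]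

theorem face_count {P : PlaneGraph V} {f : Finset (Sym2 V)} (hf : f ∈ P.faces) (X : Finset V) :
    2 * (X ∩ edgeVerts f).card = 2 * (f ∩ EIn P X).card + (f ∩ cut P X).card := by
  rw [← sum_deg P X (face_sub P hf), ← Finset.sum_inter_add_sum_sdiff X (edgeVerts f)]
  rw [Finset.sum_congr rfl (g := fun _ => 2)
    (fun v hv => deg_face hf (Finset.mem_inter.1 hv).2)]
  rw [Finset.sum_eq_zero (s := X \ edgeVerts f)]
  · simp [mul_comm]
  · intro v hv
    have := mt deg_pos.1 (Finset.mem_sdiff.1 hv).2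
    omega

theorem vert_count {P : PlaneGraph V} (hP : IsFullerene P) (X : Finset V) :
    3 * X.card = 2 * (EIn P X).card + (cut P X).card := by
  have := sum_deg P X (subset_refl (ed P))
  rw [Finset.sum_congr rfl (fun v _ => deg_ed hP v), Finset.inter_eq_right.2 (EIn_sub P X),
    Finset.inter_eq_right.2 (cut_sub P X)] at this
  simpa [mul_comm] using this

theorem sum_faces (P : PlaneGraph V) {A : Finset (Sym2 V)} (hA : A ⊆ ed P) :
    ∑ f ∈ P.faces, (f ∩ A).card = 2 * A.card := by
  have := Finset.sum_card_bipartiteAbove_eq_sum_card_bipartiteBelow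
    (s := P.faces) (t := A) (fun f (e : Sym2 V) => e ∈ f)
  have h2 : ∑ e ∈ A, (P.faces.filter fun f => e ∈ f).card = ∑ e ∈ A, 2 :=
    Finset.sum_congr rfl (fun e he => P.edge_faces e (mem_ed.1 (hA he)))
  simp only [Finset.bipartiteAbove, Finset.bipartiteBelow] at this
  rw [h2] at this
  simp only [Finset.sum_const, smul_eq_mul] at this
  rw [mul_comm, ← this]
  refine Finset.sum_congr rfl fun f _ => ?_
  congr 1; ext e; simp [and_comm]

theorem euler' (P : PlaneGraph V) :
    Fintype.card V + P.faces.card = (ed P).card + 2 := by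
  have h := sum_faces P (subset_refl (ed P))
  have h2 : ∑ f ∈ P.faces, (f ∩ ed P).card = ∑ f ∈ P.faces, f.card :=
    Finset.sum_congr rfl (fun f hf => by rw [Finset.inter_eq_left.2 (face_sub P hf)])
  have := P.euler
  omega

theorem EIn_univ (P : PlaneGraph V) : EIn P Finset.univ = ed P := by
  ext e; simp [mem_EIn]

theorem cut_univ (P : PlaneGraph V) : cut P Finset.univ = ∅ := by
  ext e; simp [mem_cut]

theorem cut_empty (P : PlaneGraph V) : cut P ∅ = ∅ := by
  ext e; simp [mem_cut]

theorem card_V {P : PlaneGraph V} (hP : IsFullerene P) : 20 ≤ Fintype.card V := by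
  have h1 := vert_count hP Finset.univ
  rw [EIn_univ, cut_univ, Finset.card_empty, Finset.card_univ] at h1
  have h2 := euler' P
  have h3 : 12 ≤ P.faces.card := hP.pentTwelve ▸ Finset.card_filter_le _ _
  omega

/-- two edges at a vertex lie on a common face -/
theorem corner {P : PlaneGraph V} (hP : IsFullerene P) {v : V} {e g : Sym2 V}
    (he : e ∈ ed P) (hg : g ∈ ed P) (hve : v ∈ e) (hvg : v ∈ g) :
    ∃ f ∈ P.faces, e ∈ f ∧ g ∈ f := by
  by_cases heg : e = g
  · subst heg
    have h := P.edge_faces e (mem_ed.1 he)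
    obtain ⟨f, hf⟩ := Finset.card_pos.1 (by omega : 0 < (P.faces.filter fun f => e ∈ f).card)
    simp at hf
    exact ⟨f, hf.1, hf.2, hf.2⟩
  by_contra hcon
  push Not at hcon
  -- third edge
  have h3 : ((ed P).filter fun e => v ∈ e).card = 3 := deg_ed hP v
  obtain ⟨h, hh⟩ : ∃ h, (ed P).filter (fun e => v ∈ e) = {e, g, h} := by
    have hsub : ({e, g} : Finset (Sym2 V)) ⊆ (ed P).filter (fun e => v ∈ e) := by
      intro x hx; simp at hx; rcases hx with rfl | rfl <;> simp [*]
    have hc := Finset.card_sdiff_of_subset hsub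
    rw [h3, Finset.card_pair heg] at hc
    obtain ⟨h, hh⟩ := Finset.card_eq_one.1 hc
    refine ⟨h, ?_⟩
    rw [← Finset.sdiff_union_of_subset hsub, hh]
    ext x; simp; tauto
  have hmem : ∀ x, (x ∈ ed P ∧ v ∈ x) ↔ (x = e ∨ x = g ∨ x = h) := by
    intro x
    rw [← Finset.mem_filter (s := ed P) (p := fun e => v ∈ e), hh]; simp
  have hhed := (hmem h).2 (by simp)
  -- every face at `v` contains exactly two of the three
  have key : ∀ f ∈ P.faces, (e ∈ f ∨ g ∈ f) → h ∈ f := by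
    intro f hf hor
    by_contra hhf
    have hvf : v ∈ edgeVerts f := mem_edgeVerts.2 (by
      rcases hor with h' | h'
      · exact ⟨e, h', hve⟩
      · exact ⟨g, h', hvg⟩)
    have hd := deg_face hf hvf
    rw [deg] at hd
    obtain ⟨x, y, hxy, hx⟩ := Finset.card_eq_two.1 hd
    have hxm : x ∈ f ∧ v ∈ x := by
      rw [← Finset.mem_filter (s := f) (p := fun e => v ∈ e), hx]; simp
    have hym : y ∈ f ∧ v ∈ y := by
      rw [← Finset.mem_filter (s := f) (p := fun e => v ∈ e), hx]; simp
    have hx' := (hmem x).1 ⟨face_sub P hf hxm.1, hxm.2⟩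
    have hy' := (hmem y).1 ⟨face_sub P hf hym.1, hym.2⟩
    have := hcon f hf
    rcases hx' with rfl | rfl | rfl <;> rcases hy' with rfl | rfl | rfl <;> simp_all
  have c1 := P.edge_faces e (mem_ed.1 he)
  have c2 := P.edge_faces g (mem_ed.1 hg)
  have c3 := P.edge_faces h (mem_ed.1 hhed.1)
  have hdisj : Disjoint (P.faces.filter fun f => e ∈ f) (P.faces.filter fun f => g ∈ f) := by
    rw [Finset.disjoint_left]
    intro f h1 h2
    simp at h1 h2
    exact hcon f h1.1 h1.2 h2.2
  have hle : ((P.faces.filter fun f => e ∈ f) ∪ (P.faces.filter fun f => g ∈ f)).card ≤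
      (P.faces.filter fun f => h ∈ f).card := by
    apply Finset.card_le_card
    intro f hf
    simp at hf ⊢
    rcases hf with hf | hf
    · exact ⟨hf.1, key f hf.1 (Or.inl hf.2)⟩
    · exact ⟨hf.1, key f hf.1 (Or.inr hf.2)⟩
  rw [Finset.card_union_of_disjoint hdisj] at hle
  omega


/-! ### Small edge cuts -/

theorem EIn_inter_cut (P : PlaneGraph V) (X : Finset V) : EIn P X ∩ cut P X = ∅ := by
  ext e
  simp only [Finset.mem_inter, mem_EIn, mem_cut, Finset.notMem_empty, iff_false]
  rintro ⟨⟨_, h⟩, _, _, v, hv, hv'⟩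
  exact hv' (h v hv)

theorem sum_deg_EIn (P : PlaneGraph V) (X : Finset V) :
    ∑ v ∈ X, deg (EIn P X) v = 2 * (EIn P X).card := by
  rw [sum_deg P X (EIn_sub P X), EIn_inter_cut]; simp

theorem sum_deg_cut (P : PlaneGraph V) (X : Finset V) :
    ∑ v ∈ X, deg (cut P X) v = (cut P X).card := by
  rw [sum_deg P X (cut_sub P X), Finset.inter_comm, EIn_inter_cut]; simp

theorem two_EIn_le (P : PlaneGraph V) (X : Finset V) :
    2 * (EIn P X).card ≤ X.card * (X.card - 1) := by
  rw [← sum_deg_EIn, ← smul_eq_mul]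
  apply Finset.sum_le_card_nsmul
  intro v hv
  rw [deg_eq_ncard P, ← Finset.card_erase_of_mem hv, ← Set.ncard_coe_finset]
  apply Set.ncard_le_ncard
  · intro w hw
    have hw' := mem_EIn.1 hw
    have hne : v ≠ w := (mem_ed.1 hw'.1 : P.graph.Adj v w).ne
    simp [hne.symm, hw'.2 w (by simp)]
  · exact Finset.finite_toSet _

theorem conn_edge {P : PlaneGraph V} (hP : IsFullerene P) (s : Finset V) (hs : s.card ≤ 2)
    (X : Finset V) {a b : V} (ha : a ∈ X) (has : a ∉ s) (hb : b ∉ X) (hbs : b ∉ s) :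
    ∃ u w, u ∈ X ∧ w ∉ X ∧ u ∉ s ∧ w ∉ s ∧ P.graph.Adj u w := by
  have hc := hP.threeConnected (s : Set V) (by rwa [Set.ncard_coe_finset])
  obtain ⟨p⟩ := hc.preconnected ⟨a, by simpa using has⟩ ⟨b, by simpa using hbs⟩
  obtain ⟨d, _, h1, h2⟩ := p.exists_boundary_dart {x | x.1 ∈ X} ha hb
  exact ⟨d.fst.1, d.snd.1, h1, h2, fun h => d.fst.2 (Finset.mem_coe.2 h),
    fun h => d.snd.2 (Finset.mem_coe.2 h), d.adj⟩

theorem mem_cut_of {P : PlaneGraph V} {X : Finset V} {u w : V} (h : P.graph.Adj u w)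
    (hu : u ∈ X) (hw : w ∉ X) : s(u, w) ∈ cut P X :=
  mem_cut.2 ⟨mem_ed.2 h, ⟨u, by simp, hu⟩, ⟨w, by simp, hw⟩⟩

theorem small_cut {P : PlaneGraph V} (hP : IsFullerene P) {X : Finset V}
    (h : (cut P X).card ≤ 2) : X = ∅ ∨ X = Finset.univ := by
  by_contra hcon
  push Not at hcon
  obtain ⟨hne, hnu⟩ := hcon
  have hXpos : 0 < X.card := Finset.card_pos.2 hne
  have hv := vert_count hP X
  have he := two_EIn_le P X
  have h3 : 3 ≤ X.card := by
    by_contra hlt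
    have : X.card = 1 ∨ X.card = 2 := by omega
    rcases this with h' | h' <;> rw [h'] at hv he <;> omega
  set s := X.filter (fun v => v ∈ edgeVerts (cut P X)) with hs
  have hsc : s.card ≤ (cut P X).card := by
    rw [← sum_deg_cut]
    calc s.card = ∑ v ∈ s, 1 := by simp
      _ ≤ ∑ v ∈ s, deg (cut P X) v := Finset.sum_le_sum fun v hv => by
          have := deg_pos.2 (Finset.mem_filter.1 hv).2
          omega
      _ ≤ _ := Finset.sum_le_sum_of_subset (Finset.filter_subset _ _)
  obtain ⟨a, ha, has⟩ : ∃ a ∈ X, a ∉ s := by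
    by_contra hc
    push Not at hc
    have := Finset.card_le_card (show X ⊆ s from hc)
    omega
  obtain ⟨b, hb⟩ : ∃ b, b ∉ X := by
    by_contra hc; push Not at hc; exact hnu (Finset.eq_univ_iff_forall.2 hc)
  obtain ⟨u, w, hu, hw, hus, -, hadj⟩ := conn_edge hP s (by omega) X ha has hb
    (fun hbs => hb (Finset.mem_filter.1 hbs).1)
  exact hus (Finset.mem_filter.2 ⟨hu, mem_edgeVerts.2 ⟨_, mem_cut_of hadj hu hw, by simp⟩⟩)

theorem cut_ne {P : PlaneGraph V} {X : Finset V} (h : 0 < (cut P X).card) :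
    X ≠ ∅ ∧ X ≠ Finset.univ := by
  constructor <;> rintro rfl
  · simp [cut_empty] at h
  · simp [cut_univ] at h

/-- sides of a cut of size at most five are connected -/
theorem side_conn {P : PlaneGraph V} (hP : IsFullerene P) {X Z : Finset V}
    (h : (cut P X).card ≤ 5) (hZX : Z ⊆ X) (hXne : X ≠ Finset.univ)
    (hno : ∀ u ∈ Z, ∀ w ∈ X, w ∉ Z → ¬ P.graph.Adj u w) : Z = ∅ ∨ Z = X := by
  by_contra hcon
  push Not at hcon
  obtain ⟨hne, hnu⟩ := hcon
  have hd : Disjoint (cut P Z) (cut P (X \ Z)) := by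
    rw [Finset.disjoint_left]
    intro e h1 h2
    induction e using Sym2.ind with
    | _ a b =>
    simp only [mem_cut, Sym2.mem_iff, Finset.mem_sdiff, mem_ed] at h1 h2
    obtain ⟨h1e, ⟨x, hx, hx1⟩, ⟨y, hy, hy1⟩⟩ := h1
    obtain ⟨-, ⟨z, hz, hz1⟩, -⟩ := h2
    have hxz : P.graph.Adj x z := by
      have hadj : P.graph.Adj a b := h1e
      have hne : x ≠ z := by rintro rfl; exact hz1.2 hx1
      rcases hx with rfl | rfl <;> rcases hz with rfl | rfl
      · exact absurd rfl hne
      · exact hadj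
      · exact hadj.symm
      · exact absurd rfl hne
    exact hno x hx1 z hz1.1 hz1.2 hxz
  have hsub : cut P Z ∪ cut P (X \ Z) ⊆ cut P X := by
    intro e he
    induction e using Sym2.ind with
    | _ a b =>
    have hed : s(a, b) ∈ ed P := by
      rcases Finset.mem_union.1 he with h | h <;> exact cut_sub _ _ h
    have hadj : P.graph.Adj a b := mem_ed.1 hed
    have h3 : a ∈ Z → a ∈ X := fun h => hZX h
    have h4 : b ∈ Z → b ∈ X := fun h => hZX h
    have n1' : a ∈ Z → b ∈ X → b ∈ Z := fun h1 h2 => by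
      by_contra h3; exact hno a h1 b h2 h3 hadj
    have n2' : b ∈ Z → a ∈ X → a ∈ Z := fun h1 h2 => by
      by_contra h3; exact hno b h1 a h2 h3 hadj.symm
    simp only [Finset.mem_union, mem_cut, Finset.mem_sdiff, hed, true_and, Sym2.mem_iff,
      exists_eq_or_imp, exists_eq_left] at he ⊢
    clear hno hd hne hnu h hed hadj hXne hZX
    by_cases a1 : a ∈ Z <;> by_cases a2 : a ∈ X <;> by_cases b1 : b ∈ Z <;>
      by_cases b2 : b ∈ X <;> simp_all
  have hle := Finset.card_le_card hsub
  rw [Finset.card_union_of_disjoint hd] at hle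
  have hZu : Z ≠ Finset.univ := by
    rintro rfl; exact hXne (Finset.eq_univ_of_forall fun x => hZX (Finset.mem_univ x))
  have h1 : ¬ (cut P Z).card ≤ 2 := fun h' => by
    rcases small_cut hP h' with h' | h'
    · exact hne.ne_empty h'
    · exact hZu h'
  have h2 : ¬ (cut P (X \ Z)).card ≤ 2 := fun h' => by
    rcases small_cut hP h' with h' | h'
    · exact hnu (Finset.Subset.antisymm hZX (Finset.sdiff_eq_empty_iff_subset.1 h'))
    · apply hXne
      exact Finset.eq_univ_of_forall fun x =>
        (Finset.mem_sdiff.1 (h' ▸ Finset.mem_univ x)).1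
  omega


/-! ### Euler inequality for one side of a cut -/

/-- faces inside `X` -/
noncomputable def Phi (P : PlaneGraph V) (X : Finset V) : Finset (Finset (Sym2 V)) :=
  P.faces.filter fun f => f ⊆ EIn P X

theorem mem_Phi {P : PlaneGraph V} {X : Finset V} {f : Finset (Sym2 V)} :
    f ∈ Phi P X ↔ f ∈ P.faces ∧ f ⊆ EIn P X := by
  simp [Phi]

/-- a labelling of faces that agrees across edges is zero everywhere once it is zero on the
faces which are not inside `X` -/
theorem faces_indep {P : PlaneGraph V} (hP : IsFullerene P) {X : Finset V}
    (hX : X ≠ Finset.univ) (s : Finset (Sym2 V) → ZMod 2)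
    (hs0 : ∀ f ∈ P.faces, s f ≠ 0 → f ⊆ EIn P X)
    (hs : ∀ e ∈ ed P, ∑ f ∈ P.faces.filter (fun f => e ∈ f), s f = 0) :
    ∀ f ∈ P.faces, s f = 0 := by
  have share : ∀ f ∈ P.faces, ∀ g ∈ P.faces, ∀ e, e ∈ f → e ∈ g → s f = s g := by
    intro f hf g hg e hef heg
    by_cases hfg : f = g
    · rw [hfg]
    have he := face_sub P hf hef
    have h2 := P.edge_faces e (mem_ed.1 he)
    have hsub : ({f, g} : Finset (Finset (Sym2 V))) ⊆ P.faces.filter (fun f => e ∈ f) := by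
      intro x hx; simp at hx; rcases hx with rfl | rfl <;> simp [*]
    have heq := Finset.eq_of_subset_of_card_le hsub (by rw [h2, Finset.card_pair hfg])
    have := hs e he
    rw [← heq, Finset.sum_pair hfg] at this
    exact CharTwo.add_eq_zero.1 this
  have at_v : ∀ v, ∀ f ∈ P.faces, ∀ g ∈ P.faces, v ∈ edgeVerts f → v ∈ edgeVerts g →
      s f = s g := by
    intro v f hf g hg hvf hvg
    obtain ⟨e, he, hve⟩ := mem_edgeVerts.1 hvf
    obtain ⟨e', he', hve'⟩ := mem_edgeVerts.1 hvg
    obtain ⟨k, hk, h1, h2⟩ := corner hP (face_sub P hf he) (face_sub P hg he') hve hve'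
    rw [share f hf k hk e he h1, share k hk g hg e' h2 he']
  classical
  set Z : Finset V := Finset.univ.filter fun v => ∃ f ∈ P.faces, v ∈ edgeVerts f ∧ s f ≠ 0
    with hZ
  have hvface : ∀ u w, P.graph.Adj u w → ∃ f ∈ P.faces, s(u, w) ∈ f := by
    intro u w h
    obtain ⟨k, hk, h1, -⟩ := corner (v := u) (e := s(u, w)) (g := s(u, w)) hP (mem_ed.2 h)
      (mem_ed.2 h) (by simp) (by simp)
    exact ⟨k, hk, h1⟩
  intro f hf
  by_contra hsf
  have hfc : 0 < f.card := by rcases hP.faceSize f hf with h | h <;> omega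
  obtain ⟨e, he⟩ := Finset.card_pos.1 hfc
  obtain ⟨a, hae⟩ : ∃ a, a ∈ e := ⟨_, Sym2.out_fst_mem e⟩
  have haZ : a ∈ Z := by
    simp only [hZ, Finset.mem_filter, Finset.mem_univ, true_and]
    exact ⟨f, hf, mem_edgeVerts.2 ⟨e, he, hae⟩, hsf⟩
  obtain ⟨b, hb⟩ : ∃ b, b ∉ X := by
    by_contra hc; push Not at hc; exact hX (Finset.eq_univ_iff_forall.2 hc)
  have hbZ : b ∉ Z := by
    simp only [hZ, Finset.mem_filter, Finset.mem_univ, true_and]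
    rintro ⟨g, hg, hbg, hsg⟩
    obtain ⟨e', he', hbe⟩ := mem_edgeVerts.1 hbg
    exact hb ((mem_EIn.1 (hs0 g hg hsg he')).2 b hbe)
  obtain ⟨u, w, hu, hw, -, -, hadj⟩ := conn_edge hP ∅ (by simp) Z haZ (by simp) hbZ (by simp)
  obtain ⟨k, hk, hke⟩ := hvface u w hadj
  simp only [hZ, Finset.mem_filter, Finset.mem_univ, true_and] at hu hw
  obtain ⟨g, hg, hug, hsg⟩ := hu
  apply hw
  refine ⟨k, hk, mem_edgeVerts.2 ⟨_, hke, by simp⟩, ?_⟩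
  rwa [at_v u k hk g hg (mem_edgeVerts.2 ⟨_, hke, by simp⟩) hug]

theorem side_euler {P : PlaneGraph V} (hP : IsFullerene P) {X : Finset V}
    (h : (cut P X).card ≤ 5) (hne : X ≠ ∅) (hnu : X ≠ Finset.univ) :
    (Phi P X).card + X.card ≤ (EIn P X).card + 1 := by
  classical
  obtain ⟨M, hMa⟩ : ∃ M : Matrix X (EIn P X) (ZMod 2),
      ∀ v e, M v e = if v.1 ∈ e.1 then 1 else 0 := ⟨Matrix.of fun v e => _, fun _ _ => rfl⟩
  obtain ⟨N, hNa⟩ : ∃ N : Matrix (EIn P X) (Phi P X) (ZMod 2),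
      ∀ e f, N e f = if e.1 ∈ f.1 then 1 else 0 := ⟨Matrix.of fun e f => _, fun _ _ => rfl⟩
  have hMN : M * N = 0 := by
    ext v f
    obtain ⟨hf, hfX⟩ := mem_Phi.1 f.2
    have h1 : (M * N) v f = ((deg f.1 v.1 : ℕ) : ZMod 2) := by
      rw [Matrix.mul_apply]
      simp only [hMa, hNa, mul_ite, mul_one, mul_zero]
      rw [Finset.sum_coe_sort (EIn P X)
        (fun e => if e ∈ f.1 then (if v.1 ∈ e then (1 : ZMod 2) else 0) else 0)]
      rw [Finset.sum_ite_mem, Finset.inter_eq_right.2 hfX, deg, Finset.sum_boole]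
    rw [h1]
    by_cases hv : v.1 ∈ edgeVerts f.1
    · rw [deg_face hf hv]; rfl
    · have := mt deg_pos.1 hv
      rw [Nat.eq_zero_of_not_pos this]; rfl
  have hrank := Matrix.rank_add_rank_le_card_of_mul_eq_zero hMN
  have hN : N.rank = (Phi P X).card := by
    rw [Matrix.rank, LinearMap.finrank_range_of_inj]
    · simp
    · rw [← LinearMap.ker_eq_bot, LinearMap.ker_eq_bot']
      intro s hs
      let s' : Finset (Sym2 V) → ZMod 2 := fun f => if hf : f ∈ Phi P X then s ⟨f, hf⟩ else 0
      have hz : ∀ f ∈ P.faces, s' f = 0 := by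
        apply faces_indep hP hnu
        · intro f hf hsf
          by_contra hcon
          apply hsf
          simp only [s']
          rw [dif_neg]
          rw [mem_Phi]; tauto
        · intro e he
          by_cases heX : e ∈ EIn P X
          · have h2 := congrFun hs ⟨e, heX⟩
            simp only [Matrix.mulVecLin_apply, Matrix.mulVec, dotProduct, hNa, ite_mul, one_mul,
              zero_mul, Pi.zero_apply] at h2
            rw [← h2, Finset.sum_filter]
            have h3 : ∑ x : Phi P X, (if e ∈ x.1 then s x else 0) =
                ∑ x : Phi P X, (if e ∈ x.1 then s' x.1 else 0) := by
              refine Finset.sum_congr rfl fun x _ => ?_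
              simp only [s']
              rw [dif_pos x.2]
            rw [h3, Finset.sum_coe_sort (Phi P X) (fun x => if e ∈ x then s' x else 0)]
            symm
            apply Finset.sum_subset (Finset.filter_subset _ _)
            intro x _ hx
            replace hx : x ∉ Phi P X := hx
            simp only [s']
            rw [dif_neg hx]; simp
          · apply Finset.sum_eq_zero
            intro f hf
            simp only [s']
            rw [dif_neg]
            intro hf'
            exact heX ((mem_Phi.1 hf').2 (Finset.mem_filter.1 hf).2)
      ext f
      have := hz f.1 (mem_Phi.1 f.2).1
      simp only [s'] at this
      rw [dif_pos f.2] at this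
      simpa using this
  have hM : X.card ≤ M.rank + 1 := by
    rw [← Matrix.rank_transpose, Matrix.rank]
    have h1 := LinearMap.finrank_range_add_finrank_ker M.transpose.mulVecLin
    have h2 : Module.finrank (ZMod 2) (LinearMap.ker M.transpose.mulVecLin) ≤ 1 := by
      have hone : (fun _ => 1 : X → ZMod 2) ∈ LinearMap.ker M.transpose.mulVecLin := by
        rw [LinearMap.mem_ker]
        ext e
        simp only [Matrix.mulVecLin_apply, Matrix.mulVec, dotProduct, Matrix.transpose_apply, hMa,
          mul_one, Pi.zero_apply]
        rw [Finset.sum_coe_sort X (fun v => if v ∈ e.1 then (1 : ZMod 2) else 0),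
          Finset.sum_boole, ends_count P X (EIn_sub P X e.2)]
        have hnc : e.1 ∉ cut P X := fun hc => by
          have := Finset.mem_inter.2 ⟨e.2, hc⟩
          rw [EIn_inter_cut] at this
          simp at this
        rw [if_pos e.2, if_neg hnc]; rfl
      apply finrank_le_one (⟨_, hone⟩ : LinearMap.ker M.transpose.mulVecLin)
      rintro ⟨x, hx⟩
      obtain ⟨v0, hv0⟩ := Finset.nonempty_iff_ne_empty.2 hne
      refine ⟨x ⟨v0, hv0⟩, ?_⟩
      have hedge : ∀ (u w : V) (hu : u ∈ X) (hw : w ∈ X), P.graph.Adj u w →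
          x ⟨u, hu⟩ = x ⟨w, hw⟩ := by
        intro u w hu hw hadj
        have he : s(u, w) ∈ EIn P X := mem_EIn.2 ⟨mem_ed.2 hadj, by
          intro v hv; simp at hv; rcases hv with rfl | rfl <;> assumption⟩
        have h2 := congrFun (LinearMap.mem_ker.1 hx) ⟨_, he⟩
        simp only [Matrix.mulVecLin_apply, Matrix.mulVec, dotProduct, Matrix.transpose_apply, hMa,
          ite_mul, one_mul, zero_mul, Pi.zero_apply] at h2
        rw [← Finset.sum_filter] at h2
        have h3 : (Finset.univ.filter fun a : X => a.1 ∈ s(u, w)) = {⟨u, hu⟩, ⟨w, hw⟩} := by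
          ext a; simp [Subtype.ext_iff]
        rw [h3, Finset.sum_pair (by simpa using hadj.ne)] at h2
        exact CharTwo.add_eq_zero.1 h2
      let Z : Finset V := X.filter fun v => ∃ hv : v ∈ X, x ⟨v, hv⟩ = x ⟨v0, hv0⟩
      have hZ := side_conn hP (X := X) (Z := Z) h (Finset.filter_subset _ _) hnu (by
        intro u hu w hw hwZ hadj
        obtain ⟨hu1, hu2, hu3⟩ := Finset.mem_filter.1 hu
        apply hwZ
        refine Finset.mem_filter.2 ⟨hw, hw, ?_⟩
        rw [← hu3, hedge u w hu2 hw hadj])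
      have hv0Z : v0 ∈ Z := Finset.mem_filter.2 ⟨hv0, hv0, rfl⟩
      rcases hZ with hZ | hZ
      · rw [hZ] at hv0Z; simp at hv0Z
      · apply Subtype.ext
        funext a
        have ha : a.1 ∈ Z := by rw [hZ]; exact a.2
        obtain ⟨_, _, h3⟩ := Finset.mem_filter.1 ha
        simpa using h3.symm
    rw [Module.finrank_fintype_fun_eq_card, Fintype.card_coe] at h1
    omega
  rw [hN, Fintype.card_coe] at hrank
  omega


/-! ### Crossing faces -/

/-- faces crossing the cut of `X` -/
noncomputable def Kf (P : PlaneGraph V) (X : Finset V) : Finset (Finset (Sym2 V)) :=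
  P.faces.filter fun f => (f ∩ cut P X).Nonempty

/-- number of face-edge incidences inside `X` on crossing faces -/
noncomputable def bd (P : PlaneGraph V) (X : Finset V) : ℕ :=
  ∑ f ∈ Kf P X, (f ∩ EIn P X).card

open Classical in
/-- vertices of `X` on crossing faces -/
noncomputable def Nb (P : PlaneGraph V) (X : Finset V) : Finset V :=
  X.filter fun v => ∃ f ∈ Kf P X, v ∈ edgeVerts f

theorem mem_Kf {P : PlaneGraph V} {X : Finset V} {f : Finset (Sym2 V)} :
    f ∈ Kf P X ↔ f ∈ P.faces ∧ (f ∩ cut P X).Nonempty := by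
  simp [Kf]

theorem mem_Kf_of {P : PlaneGraph V} {X : Finset V} {f : Finset (Sym2 V)} {e : Sym2 V}
    (hf : f ∈ P.faces) (he : e ∈ f) (hc : e ∈ cut P X) : f ∈ Kf P X :=
  mem_Kf.2 ⟨hf, e, Finset.mem_inter.2 ⟨he, hc⟩⟩

theorem mem_Nb {P : PlaneGraph V} {X : Finset V} {v : V} :
    v ∈ Nb P X ↔ v ∈ X ∧ ∃ f ∈ Kf P X, v ∈ edgeVerts f := by
  simp [Nb]

theorem Kf_compl (P : PlaneGraph V) (X : Finset V) : Kf P Xᶜ = Kf P X := by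
  simp only [Kf, cut_compl]

theorem two_le_cross {P : PlaneGraph V} {X : Finset V} {f : Finset (Sym2 V)}
    (hf : f ∈ Kf P X) : 2 ≤ (f ∩ cut P X).card := by
  obtain ⟨h1, h2⟩ := mem_Kf.1 hf
  have := face_count h1 X
  have := Finset.card_pos.2 h2
  omega

theorem sum_cross (P : PlaneGraph V) (X : Finset V) :
    ∑ f ∈ Kf P X, (f ∩ cut P X).card = 2 * (cut P X).card := by
  rw [← sum_faces P (cut_sub P X)]
  apply Finset.sum_subset (Finset.filter_subset _ _)
  intro f hf hfK
  rw [Finset.card_eq_zero]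
  by_contra h
  exact hfK (mem_Kf.2 ⟨hf, Finset.nonempty_iff_ne_empty.2 h⟩)

theorem card_Kf (P : PlaneGraph V) (X : Finset V) : (Kf P X).card ≤ (cut P X).card := by
  have h1 : (Kf P X).card • 2 ≤ ∑ f ∈ Kf P X, (f ∩ cut P X).card :=
    Finset.card_nsmul_le_sum _ _ _ fun f hf => two_le_cross hf
  rw [sum_cross, smul_eq_mul] at h1
  omega

theorem noncross {P : PlaneGraph V} {X : Finset V} {f : Finset (Sym2 V)} (hf : f ∈ P.faces)
    (hK : f ∉ Kf P X) : f ∈ Phi P X ∨ f ∈ Phi P Xᶜ := by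
  have main : ∀ Y : Finset V, f ∉ Kf P Y → ∀ (v : V) (c : P.graph.Walk v v),
      c.edges.toFinset = f → v ∈ Y → f ∈ Phi P Y := by
    intro Y hKY v c hc hv
    refine mem_Phi.2 ⟨hf, fun e he => mem_EIn.2 ⟨face_sub P hf he, fun w hw => ?_⟩⟩
    by_contra hwY
    have hws : w ∈ c.support := by
      obtain ⟨x, rfl⟩ := hw
      rw [← hc] at he
      exact c.fst_mem_support_of_mem_edges (by simpa using he)
    obtain ⟨d, hd, h1, h2⟩ := (c.takeUntil w hws).exists_boundary_dart (Y : Set V)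
      (by simpa using hv) (by simpa using hwY)
    apply hKY
    have hde : d.edge ∈ c.edges :=
      c.edges_takeUntil_subset_edges hws (List.mem_map_of_mem hd)
    refine mem_Kf_of (e := d.edge) hf (by rw [← hc]; simpa using hde) ?_
    exact mem_cut_of d.adj (by simpa using h1) (by simpa using h2)
  obtain ⟨v, c, -, hc⟩ := P.face_cycle f hf
  by_cases hv : v ∈ X
  · exact Or.inl (main X hK v c hc hv)
  · exact Or.inr (main Xᶜ (by rwa [Kf_compl]) v c hc (by simpa using hv))

theorem R2 {P : PlaneGraph V} (hP : IsFullerene P) {X : Finset V}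
    (h : (cut P X).card ≤ 5) (h0 : 0 < (cut P X).card) :
    2 * bd P X + 10 ≤ X.card + 3 * (cut P X).card := by
  obtain ⟨hne, hnu⟩ := cut_ne h0
  have h0' := h0
  rw [← cut_compl] at h0'
  obtain ⟨hne', hnu'⟩ := cut_ne h0'
  have e1 := side_euler hP (X := Xᶜ) (by rwa [cut_compl]) hne' hnu'
  have v1 := vert_count hP X
  have v2 := vert_count hP Xᶜ
  have v3 := vert_count hP (Finset.univ : Finset V)
  rw [EIn_univ, cut_univ, Finset.card_empty, Finset.card_univ] at v3
  rw [cut_compl] at v2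
  have hc := Finset.card_add_card_compl X
  have eu := euler' P
  have hF : P.faces.card ≤ (Phi P X).card + (Phi P Xᶜ).card + (Kf P X).card := by
    have hs : P.faces ⊆ (Phi P X ∪ Phi P Xᶜ) ∪ Kf P X := by
      intro f hf
      by_cases hK : f ∈ Kf P X
      · simp [hK]
      · rcases noncross hf hK with h | h <;> simp [h]
    have t1 := Finset.card_le_card hs
    have t2 := Finset.card_union_le (Phi P X ∪ Phi P Xᶜ) (Kf P X)
    have t3 := Finset.card_union_le (Phi P X) (Phi P Xᶜ)
    omega
  have hK := card_Kf P X
  have h5 : 5 * (Phi P X).card + bd P X ≤ 2 * (EIn P X).card := by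
    rw [← sum_faces P (EIn_sub P X)]
    have hd : Disjoint (Phi P X) (Kf P X) := by
      rw [Finset.disjoint_left]
      intro f h1 h2
      obtain ⟨e, he⟩ := (mem_Kf.1 h2).2
      obtain ⟨he1, he2⟩ := Finset.mem_inter.1 he
      have := Finset.mem_inter.2 ⟨(mem_Phi.1 h1).2 he1, he2⟩
      rw [EIn_inter_cut] at this
      simp at this
    have hs : Phi P X ∪ Kf P X ⊆ P.faces :=
      Finset.union_subset (Finset.filter_subset _ _) (Finset.filter_subset _ _)
    refine le_trans ?_ (Finset.sum_le_sum_of_subset hs)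
    rw [Finset.sum_union hd]
    have : (Phi P X).card • 5 ≤ ∑ f ∈ Phi P X, (f ∩ EIn P X).card := by
      refine Finset.card_nsmul_le_sum _ _ _ fun f hf => ?_
      obtain ⟨h1, h2⟩ := mem_Phi.1 hf
      rw [Finset.inter_eq_left.2 h2]
      rcases hP.faceSize f h1 with h | h <;> omega
    rw [smul_eq_mul] at this
    unfold bd
    omega
  omega

theorem R3 {P : PlaneGraph V} (hP : IsFullerene P) (X : Finset V) :
    bd P X + bd P Xᶜ ≤ 4 * (cut P X).card := by
  have h1 : ∑ f ∈ Kf P X, ((f ∩ EIn P X).card + (f ∩ EIn P Xᶜ).card + (f ∩ cut P X).card) ≤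
      (Kf P X).card • 6 := by
    refine Finset.sum_le_card_nsmul _ _ _ fun f hf => ?_
    have hf' := (mem_Kf.1 hf).1
    have a1 := face_count hf' X
    have a2 := face_count hf' Xᶜ
    have a3 := face_count hf' Finset.univ
    rw [cut_compl] at a2
    rw [EIn_univ, cut_univ, Finset.univ_inter, Finset.inter_eq_left.2 (face_sub P hf'),
      Finset.inter_empty, Finset.card_empty] at a3
    have a4 : (X ∩ edgeVerts f).card + (Xᶜ ∩ edgeVerts f).card = (edgeVerts f).card := by
      rw [← Finset.card_union_of_disjoint]
      · congr 1; ext v; simp; tauto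
      · rw [Finset.disjoint_left]; intro v; simp; tauto
    rcases hP.faceSize f hf' with h | h <;> omega
  rw [Finset.sum_add_distrib, Finset.sum_add_distrib, sum_cross, smul_eq_mul] at h1
  have h2 := card_Kf P X
  have h3 : bd P Xᶜ = ∑ f ∈ Kf P X, (f ∩ EIn P Xᶜ).card := by
    unfold bd; rw [Kf_compl]
  rw [h3]
  unfold bd
  omega

theorem cut_vert_Nb {P : PlaneGraph V} (hP : IsFullerene P) {X : Finset V} {v : V} (hv : v ∈ X)
    (h : 0 < deg (cut P X) v) : v ∈ Nb P X := by
  obtain ⟨e, he, hve⟩ := mem_edgeVerts.1 (deg_pos.1 h)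
  have hed := cut_sub _ _ he
  obtain ⟨k, hk, h1, -⟩ := corner hP hed hed hve hve
  exact mem_Nb.2 ⟨hv, k, mem_Kf_of hk h1 he, mem_edgeVerts.2 ⟨e, h1, hve⟩⟩

theorem sum_Nb_cut {P : PlaneGraph V} (hP : IsFullerene P) (X : Finset V) :
    ∑ v ∈ Nb P X, deg (cut P X) v = (cut P X).card := by
  rw [← sum_deg_cut]
  apply Finset.sum_subset (fun v hv => (mem_Nb.1 hv).1)
  intro v hv hvN
  by_contra h
  exact hvN (cut_vert_Nb hP hv (Nat.pos_of_ne_zero h))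

theorem R1a {P : PlaneGraph V} (hP : IsFullerene P) {X : Finset V}
    (hm : ∀ v ∈ X, deg (cut P X) v ≤ 1) : (Nb P X).card ≤ bd P X := by
  classical
  have h1 : ∑ f ∈ Kf P X, (X ∩ edgeVerts f).card = bd P X + (cut P X).card := by
    have : 2 * ∑ f ∈ Kf P X, (X ∩ edgeVerts f).card = 2 * bd P X + 2 * (cut P X).card := by
      rw [← sum_cross, bd, Finset.mul_sum, Finset.mul_sum, ← Finset.sum_add_distrib]
      exact Finset.sum_congr rfl fun f hf => face_count (mem_Kf.1 hf).1 X
    omega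
  have h2 : ∑ f ∈ Kf P X, (X ∩ edgeVerts f).card =
      ∑ v ∈ X, ((Kf P X).filter fun f => v ∈ edgeVerts f).card := by
    have := Finset.sum_card_bipartiteAbove_eq_sum_card_bipartiteBelow
      (s := Kf P X) (t := X) (fun f v => v ∈ edgeVerts f)
    simp only [Finset.bipartiteAbove, Finset.bipartiteBelow] at this
    rw [← this]
    refine Finset.sum_congr rfl fun f _ => ?_
    rw [Finset.filter_mem_eq_inter]
  have h3 : ∑ v ∈ Nb P X, (1 + deg (cut P X) v) ≤
      ∑ v ∈ X, ((Kf P X).filter fun f => v ∈ edgeVerts f).card := by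
    refine le_trans (Finset.sum_le_sum fun v hv => ?_)
      (Finset.sum_le_sum_of_subset (fun v hv => (mem_Nb.1 hv).1))
    obtain ⟨hvX, f, hf, hvf⟩ := mem_Nb.1 hv
    have hm' := hm v hvX
    by_cases hz : deg (cut P X) v = 0
    · rw [hz]
      exact Finset.card_pos.2 ⟨f, Finset.mem_filter.2 ⟨hf, hvf⟩⟩
    · obtain ⟨e, he, hve⟩ := mem_edgeVerts.1 (deg_pos.1 (Nat.pos_of_ne_zero hz))
      have h2 := P.edge_faces e (mem_ed.1 (cut_sub _ _ he))
      have : (P.faces.filter fun f => e ∈ f).card ≤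
          ((Kf P X).filter fun f => v ∈ edgeVerts f).card := by
        apply Finset.card_le_card
        intro g hg
        obtain ⟨hg1, hg2⟩ := Finset.mem_filter.1 hg
        exact Finset.mem_filter.2 ⟨mem_Kf_of hg1 hg2 he, mem_edgeVerts.2 ⟨e, hg2, hve⟩⟩
      omega
  rw [Finset.sum_add_distrib, sum_Nb_cut hP, ← h2, h1] at h3
  simp at h3
  exact h3

theorem R1b {P : PlaneGraph V} (hP : IsFullerene P) {X : Finset V}
    (hm : ∀ v ∈ X, deg (cut P X) v ≤ 1) :
    (cut P (X \ Nb P X)).card + (cut P X).card ≤ (Nb P X).card := by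
  set Z := X \ Nb P X with hZ
  have hcutZ : ∀ e ∈ cut P Z, ∃ z ∈ e, z ∈ Z ∧ ∃ y ∈ e, y ∈ Nb P X := by
    intro e he
    obtain ⟨hed, ⟨z, hz, hzZ⟩, ⟨y, hy, hyZ⟩⟩ := mem_cut.1 he
    refine ⟨z, hz, hzZ, y, hy, ?_⟩
    obtain ⟨hzX, hzN⟩ := Finset.mem_sdiff.1 hzZ
    by_contra hyN
    have hyX : y ∉ X := fun h => hyZ (Finset.mem_sdiff.2 ⟨h, hyN⟩)
    have hec : e ∈ cut P X := mem_cut.2 ⟨hed, ⟨z, hz, hzX⟩, ⟨y, hy, hyX⟩⟩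
    exact hzN (cut_vert_Nb hP hzX (deg_pos.2 (mem_edgeVerts.2 ⟨e, hec, hz⟩)))
  have hnoK : ∀ e ∈ cut P Z, ∀ f ∈ Kf P X, e ∉ f := by
    intro e he f hf hef
    obtain ⟨z, hz, hzZ, -⟩ := hcutZ e he
    obtain ⟨hzX, hzN⟩ := Finset.mem_sdiff.1 hzZ
    exact hzN (mem_Nb.2 ⟨hzX, f, hf, mem_edgeVerts.2 ⟨e, hef, hz⟩⟩)
  have h1 : (cut P Z).card ≤ ∑ v ∈ Nb P X, deg (cut P Z) v := by
    rw [sum_deg P _ (cut_sub P Z)]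
    have : cut P Z ⊆ cut P (Nb P X) := by
      intro e he
      obtain ⟨z, hz, hzZ, y, hy, hyN⟩ := hcutZ e he
      exact mem_cut.2 ⟨cut_sub _ _ he, ⟨y, hy, hyN⟩, ⟨z, hz, (Finset.mem_sdiff.1 hzZ).2⟩⟩
    rw [Finset.inter_eq_left.2 this]
    omega
  have h2 : ∑ v ∈ Nb P X, (deg (cut P Z) v + deg (cut P X) v) ≤ (Nb P X).card • 1 := by
    refine Finset.sum_le_card_nsmul _ _ _ fun v hv => ?_
    obtain ⟨hvX, f, hf, hvf⟩ := mem_Nb.1 hv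
    have hm' := hm v hvX
    by_cases hz : deg (cut P X) v = 0
    · rw [hz]
      have hff := (mem_Kf.1 hf).1
      have d3 := deg_ed hP v
      have d2 := deg_face hff hvf
      unfold deg at d2 d3 ⊢
      have hd : Disjoint ((cut P Z).filter fun e => v ∈ e) (f.filter fun e => v ∈ e) := by
        rw [Finset.disjoint_left]
        intro e h1 h2
        exact hnoK e (Finset.mem_filter.1 h1).1 f hf (Finset.mem_filter.1 h2).1
      have hs : ((cut P Z).filter fun e => v ∈ e) ∪ (f.filter fun e => v ∈ e) ⊆
          (ed P).filter fun e => v ∈ e :=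
        Finset.union_subset (Finset.filter_subset_filter _ (cut_sub _ _))
          (Finset.filter_subset_filter _ (face_sub _ hff))
      have := Finset.card_le_card hs
      rw [Finset.card_union_of_disjoint hd] at this
      omega
    · have : deg (cut P Z) v = 0 := by
        by_contra hne
        obtain ⟨e, he, hve⟩ := mem_edgeVerts.1 (deg_pos.1 (Nat.pos_of_ne_zero hz))
        obtain ⟨g, hg, hvg⟩ := mem_edgeVerts.1 (deg_pos.1 (Nat.pos_of_ne_zero hne))
        obtain ⟨k, hk, hek, hgk⟩ := corner hP (cut_sub _ _ he) (cut_sub _ _ hg) hve hvg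
        exact hnoK g hg k (mem_Kf_of hk hek he) hgk
      omega
  rw [Finset.sum_add_distrib, sum_Nb_cut hP] at h2
  simp at h2
  omega


/-! ### Cyclic edge-connectivity -/

theorem deg_split {P : PlaneGraph V} (hP : IsFullerene P) {X : Finset V} {v : V} (hv : v ∈ X) :
    deg (EIn P X) v + deg (cut P X) v = 3 := by
  rw [← deg_ed hP v]
  unfold deg
  rw [← Finset.card_union_of_disjoint]
  · congr 1
    ext e
    simp only [Finset.mem_union, Finset.mem_filter, mem_EIn, mem_cut]
    constructor
    · tauto
    · rintro ⟨h1, h2⟩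
      by_cases h : ∀ w ∈ e, w ∈ X
      · exact Or.inl ⟨⟨h1, h⟩, h2⟩
      · push Not at h
        exact Or.inr ⟨⟨h1, ⟨v, h2, hv⟩, h⟩, h2⟩
  · rw [Finset.disjoint_left]
    intro e h1 h2
    have := Finset.mem_inter.2 ⟨(Finset.mem_filter.1 h1).1, (Finset.mem_filter.1 h2).1⟩
    rw [EIn_inter_cut] at this
    simp at this

theorem cut_erase {P : PlaneGraph V} (hP : IsFullerene P) {X : Finset V} {v : V} (hv : v ∈ X) :
    (cut P (X.erase v)).card + 2 * deg (cut P X) v = (cut P X).card + 3 := by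
  have h1 := vert_count hP X
  have h2 := vert_count hP (X.erase v)
  have h3 := deg_split hP hv
  have h4 := Finset.card_erase_add_one hv
  have h5 : (EIn P X).card = (EIn P (X.erase v)).card + deg (EIn P X) v := by
    unfold deg
    rw [← Finset.card_filter_add_card_filter_not (s := EIn P X) (fun e => v ∈ e), add_comm]
    congr 2
    ext e
    simp only [Finset.mem_filter, mem_EIn, Finset.mem_erase]
    constructor
    · rintro ⟨⟨h1, h2⟩, h3⟩
      exact ⟨h1, fun w hw => ⟨by rintro rfl; exact h3 hw, h2 w hw⟩⟩
    · rintro ⟨h1, h2⟩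
      exact ⟨⟨h1, fun w hw => (h2 w hw).2⟩, fun hve => (h2 v hve).1 rfl⟩
  omega

theorem erase_ne_univ (X : Finset V) (v : V) : X.erase v ≠ Finset.univ := by
  intro h
  have := Finset.mem_univ v
  rw [← h] at this
  simp at this

theorem matched3 {P : PlaneGraph V} (hP : IsFullerene P) {X : Finset V}
    (h : (cut P X).card = 3) (h1 : X.card ≠ 1) : ∀ v ∈ X, deg (cut P X) v ≤ 1 := by
  intro v hv
  by_contra hc
  have := cut_erase hP hv
  have h4 := Finset.card_erase_add_one hv
  rcases small_cut hP (X := X.erase v) (by omega) with h' | h'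
  · rw [h'] at h4; simp at h4; omega
  · exact erase_ne_univ X v h'

theorem cut3 {P : PlaneGraph V} (hP : IsFullerene P) : ∀ (n : ℕ) (X : Finset V), X.card = n →
    (cut P X).card = 3 → X.card = 1 ∨ Xᶜ.card = 1 := by
  intro n
  induction n using Nat.strong_induction_on with
  | _ n ih =>
  intro X hn h
  by_contra hcon
  push Not at hcon
  obtain ⟨hX1, hX2⟩ := hcon
  have hc' : (cut P Xᶜ).card = 3 := by rw [cut_compl]; exact h
  have hm := matched3 hP h hX1
  have hm' := matched3 hP hc' hX2
  have hV := card_V hP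
  have hcV := Finset.card_add_card_compl X
  have small : ∀ Y : Finset V, (cut P Y).card = 3 → (∀ v ∈ Y, deg (cut P Y) v ≤ 1) →
      6 ≤ bd P Y := by
    intro Y hY hmY
    by_contra hlt
    have a1 := R1a hP hmY
    have a2 := R1b hP hmY
    have a3 := R2 hP (X := Y) (by omega) (by omega)
    have hYu := (cut_ne (P := P) (X := Y) (by omega)).2
    rcases small_cut hP (X := Y \ Nb P Y) (by omega) with h' | h'
    · have := Finset.card_le_card (Finset.sdiff_eq_empty_iff_subset.1 h')
      omega
    · apply hYu
      exact Finset.eq_univ_of_forall fun x => (Finset.mem_sdiff.1 (h' ▸ Finset.mem_univ x)).1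
  have b1 := small X h hm
  have b2 := small Xᶜ hc' hm'
  have b3 := R3 hP X
  have a1 := R1a hP hm
  have a2 := R1b hP hm
  have a3 := R2 hP (X := X) (by omega) (by omega)
  have hNX : Nb P X ⊆ X := fun v hv => (mem_Nb.1 hv).1
  have hZc := Finset.card_sdiff_add_card_eq_card hNX
  have hZV := Finset.card_add_card_compl (X \ Nb P X)
  obtain ⟨_, hXu⟩ := cut_ne (P := P) (X := X) (by omega)
  have hXcpos : 0 < Xᶜ.card := Finset.card_pos.2 (by
    rw [Finset.nonempty_iff_ne_empty]; simpa using hXu)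
  have hge : 3 ≤ (cut P (X \ Nb P X)).card := by
    by_contra hlt
    rcases small_cut hP (X := X \ Nb P X) (by omega) with h' | h'
    · rw [h'] at hZc; simp at hZc; omega
    · rw [h'] at hZc; rw [Finset.card_univ] at hZc; omega
  rcases ih (X \ Nb P X).card (by omega) (X \ Nb P X) rfl (by omega) with h' | h' <;> omega

theorem card_one_cut {P : PlaneGraph V} (hP : IsFullerene P) {X : Finset V} (h : X.card = 1) :
    (cut P X).card = 3 := by
  have h1 := vert_count hP X
  have h2 := two_EIn_le P X
  rw [h] at h1 h2
  omega

theorem matched4 {P : PlaneGraph V} (hP : IsFullerene P) {X : Finset V}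
    (h : (cut P X).card = 4) (h1 : X.card ≠ 2) : ∀ v ∈ X, deg (cut P X) v ≤ 1 := by
  intro v hv
  by_contra hc
  have := cut_erase hP hv
  have h4 := Finset.card_erase_add_one hv
  have hX1 : X.card ≠ 1 := fun h' => by have := card_one_cut hP h'; omega
  have hcV := Finset.card_add_card_compl X
  have hcV' := Finset.card_add_card_compl (X.erase v)
  obtain ⟨_, hXu⟩ := cut_ne (P := P) (X := X) (by omega)
  have hXcpos : 0 < Xᶜ.card := Finset.card_pos.2 (by
    rw [Finset.nonempty_iff_ne_empty]; simpa using hXu)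
  by_cases hle : (cut P (X.erase v)).card ≤ 2
  · rcases small_cut hP hle with h' | h'
    · rw [h'] at h4; simp at h4; omega
    · exact erase_ne_univ X v h'
  · rcases cut3 hP _ (X.erase v) rfl (by omega) with h' | h' <;> omega

theorem cut4 {P : PlaneGraph V} (hP : IsFullerene P) : ∀ (n : ℕ) (X : Finset V), X.card = n →
    (cut P X).card = 4 → X.card = 2 ∨ Xᶜ.card = 2 := by
  intro n
  induction n using Nat.strong_induction_on with
  | _ n ih =>
  intro X hn h
  by_contra hcon
  push Not at hcon
  obtain ⟨hX1, hX2⟩ := hcon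
  have hc' : (cut P Xᶜ).card = 4 := by rw [cut_compl]; exact h
  have hm := matched4 hP h hX1
  have hm' := matched4 hP hc' hX2
  have hV := card_V hP
  have hcV := Finset.card_add_card_compl X
  have pos : ∀ Y : Finset V, (cut P Y).card = 4 → 2 ≤ Yᶜ.card := by
    intro Y hY
    obtain ⟨_, hYu⟩ := cut_ne (P := P) (X := Y) (by omega)
    have h0 : 0 < Yᶜ.card := Finset.card_pos.2 (by
      rw [Finset.nonempty_iff_ne_empty]; simpa using hYu)
    have h1 : Yᶜ.card ≠ 1 := fun h' => by
      have := card_one_cut hP h'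
      rw [cut_compl] at this
      omega
    omega
  have small : ∀ Y : Finset V, (cut P Y).card = 4 → (∀ v ∈ Y, deg (cut P Y) v ≤ 1) →
      8 ≤ bd P Y := by
    intro Y hY hmY
    by_contra hlt
    have a1 := R1a hP hmY
    have a2 := R1b hP hmY
    have a3 := R2 hP (X := Y) (by omega) (by omega)
    have hNY : Nb P Y ⊆ Y := fun v hv => (mem_Nb.1 hv).1
    have hZc := Finset.card_sdiff_add_card_eq_card hNY
    have hZV := Finset.card_add_card_compl (Y \ Nb P Y)
    have hYV := Finset.card_add_card_compl Y
    have hp := pos Y hY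
    by_cases hle : (cut P (Y \ Nb P Y)).card ≤ 2
    · rcases small_cut hP hle with h' | h'
      · rw [h'] at hZc; simp at hZc; omega
      · rw [h'] at hZc; rw [Finset.card_univ] at hZc; omega
    · rcases cut3 hP _ (Y \ Nb P Y) rfl (by omega) with h' | h' <;> omega
  have b1 := small X h hm
  have b2 := small Xᶜ hc' hm'
  have b3 := R3 hP X
  have a1 := R1a hP hm
  have a2 := R1b hP hm
  have a3 := R2 hP (X := X) (by omega) (by omega)
  have hNX : Nb P X ⊆ X := fun v hv => (mem_Nb.1 hv).1
  have hZc := Finset.card_sdiff_add_card_eq_card hNX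
  have hZV := Finset.card_add_card_compl (X \ Nb P X)
  have hp := pos X h
  have hge : 3 ≤ (cut P (X \ Nb P X)).card := by
    by_contra hlt
    rcases small_cut hP (X := X \ Nb P X) (by omega) with h' | h'
    · rw [h'] at hZc; simp at hZc; omega
    · rw [h'] at hZc; rw [Finset.card_univ] at hZc; omega
  by_cases h3 : (cut P (X \ Nb P X)).card = 3
  · rcases cut3 hP _ (X \ Nb P X) rfl h3 with h' | h' <;> omega
  · rcases ih (X \ Nb P X).card (by omega) (X \ Nb P X) rfl (by omega) with h' | h' <;> omega

/-- no three vertices spanning three edges -/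
theorem no_tri {P : PlaneGraph V} (hP : IsFullerene P) {Q : Finset V} (hQ : Q.card = 3) :
    (EIn P Q).card ≤ 2 := by
  by_contra hc
  have h1 := vert_count hP Q
  have hV := card_V hP
  have hcV := Finset.card_add_card_compl Q
  by_cases h3 : (cut P Q).card ≤ 2
  · rcases small_cut hP h3 with h' | h'
    · rw [h'] at hQ; simp at hQ
    · rw [h', Finset.card_univ] at hQ; omega
  · rcases cut3 hP _ Q rfl (by omega) with h' | h' <;> omega

/-- no four vertices spanning four edges -/
theorem no_quad {P : PlaneGraph V} (hP : IsFullerene P) {Q : Finset V} (hQ : Q.card = 4) :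
    (EIn P Q).card ≤ 3 := by
  by_contra hc
  have h1 := vert_count hP Q
  have hV := card_V hP
  have hcV := Finset.card_add_card_compl Q
  by_cases h3 : (cut P Q).card ≤ 2
  · rcases small_cut hP h3 with h' | h'
    · rw [h'] at hQ; simp at hQ
    · rw [h', Finset.card_univ] at hQ; omega
  · rcases cut4 hP _ Q rfl (by omega) with h' | h' <;> omega

theorem no_tri' {P : PlaneGraph V} (hP : IsFullerene P) {a b c : V} (h1 : P.graph.Adj a b)
    (h2 : P.graph.Adj b c) (h3 : P.graph.Adj a c) : False := by
  have hQ : ({a, b, c} : Finset V).card = 3 := by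
    rw [Finset.card_eq_three]
    exact ⟨a, b, c, h1.ne, h3.ne, h2.ne, rfl⟩
  have := no_tri hP hQ
  have hs : ({s(a, b), s(b, c), s(a, c)} : Finset (Sym2 V)) ⊆ EIn P {a, b, c} := by
    intro e he
    simp only [Finset.mem_insert, Finset.mem_singleton] at he
    rcases he with rfl | rfl | rfl <;> simp [mem_EIn, mem_ed, *]
  have hc := Finset.card_le_card hs
  rw [Finset.card_eq_three.2 ⟨_, _, _, ?_, ?_, ?_, rfl⟩] at hc
  · omega
  all_goals
    have := h1.ne
    have := h2.ne
    have := h3.ne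
    simp only [ne_eq, Sym2.eq_iff]
    grind

theorem no_quad' {P : PlaneGraph V} (hP : IsFullerene P) {a b c d : V} (hac : a ≠ c)
    (hbd : b ≠ d) (h1 : P.graph.Adj a b)
    (h2 : P.graph.Adj b c) (h3 : P.graph.Adj c d) (h4 : P.graph.Adj d a) : False := by
  have n1 := h1.ne
  have n2 := h2.ne
  have n3 := h3.ne
  have n4 := h4.ne
  have hQ : ({a, b, c, d} : Finset V).card = 4 := by
    rw [Finset.card_eq_succ]
    refine ⟨a, {b, c, d}, ?_, rfl, Finset.card_eq_three.2 ⟨b, c, d, n2, hbd, n3, rfl⟩⟩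
    simp; grind
  have := no_quad hP hQ
  have hs : ({s(a, b), s(b, c), s(c, d), s(d, a)} : Finset (Sym2 V)) ⊆ EIn P {a, b, c, d} := by
    intro e he
    simp only [Finset.mem_insert, Finset.mem_singleton] at he
    rcases he with rfl | rfl | rfl | rfl <;> simp [mem_EIn, mem_ed, *]
  have hc := Finset.card_le_card hs
  rw [Finset.card_eq_succ.2 ⟨s(a, b), {s(b, c), s(c, d), s(d, a)}, ?_, rfl,
    Finset.card_eq_three.2 ⟨_, _, _, ?_, ?_, ?_, rfl⟩⟩] at hc
  · omega
  all_goals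
    simp only [ne_eq, Sym2.eq_iff, Finset.mem_insert, Finset.mem_singleton]
    grind

lemma acyclic_of_rank {U : Type} (H : SimpleGraph U) (r : U → ℕ) (hr : Function.Injective r)
    (h : ∀ v a b, H.Adj v a → H.Adj v b → r a < r v → r b < r v → a = b) : H.IsAcyclic := by
  classical
  intro v c hc
  obtain ⟨m, hm, hmax⟩ := c.support.toFinset.exists_max_image r ⟨v, by simp⟩
  have hm' : m ∈ c.support := by simpa using hm
  have h2 := hc.ncard_neighborSet_toSubgraph_eq_two hm'
  obtain ⟨a, b, hab, he⟩ := Set.ncard_eq_two.1 h2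
  have key : ∀ u, u ∈ c.toSubgraph.neighborSet m → H.Adj m u ∧ r u < r m := by
    intro u hu
    have h1 : c.toSubgraph.Adj m u := hu
    have h3 : u ∈ c.support := by
      have := h1.snd_mem
      simpa using this
    have h4 := hmax u (by simpa using h3)
    have h5 : H.Adj m u := h1.adj_sub
    refine ⟨h5, lt_of_le_of_ne h4 fun h6 => h5.ne (hr h6).symm⟩
  have ha := key a (by rw [he]; simp)
  have hb := key b (by rw [he]; simp)
  exact hab (h m a b ha.1 hb.1 ha.2 hb.2)

lemma ac_path (n : ℕ) : (SimpleGraph.pathGraph n).IsAcyclic := by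
  apply acyclic_of_rank _ (fun i : Fin n => (i : ℕ)) Fin.val_injective
  intro v a b h1 h2 h3 h4
  rw [SimpleGraph.pathGraph_adj] at h1 h2
  apply Fin.ext
  omega

lemma ac_twoK2 : twoK2.IsAcyclic := by
  apply acyclic_of_rank _ (fun i : Fin 4 => (i : ℕ)) Fin.val_injective
  simp only [twoK2, SimpleGraph.fromEdgeSet_adj]
  decide

lemma ac_T0 : treeT0.IsAcyclic := by
  apply acyclic_of_rank _ (fun i : Fin 6 => (i : ℕ)) Fin.val_injective
  simp only [treeT0, SimpleGraph.fromEdgeSet_adj]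
  decide

lemma ac_star : (completeBipartiteGraph (Fin 1) (Fin 3)).IsAcyclic := by
  apply acyclic_of_rank _ (Sum.elim (fun _ => 0) (fun j : Fin 3 => (j : ℕ) + 1))
  · decide
  · simp only [completeBipartiteGraph_adj]
    decide

lemma iso_of {U : Type} (G : SimpleGraph V) (H : SimpleGraph U) (S : Set V) (g : U → V)
    (hg : Function.Injective g) (hS : ∀ v, v ∈ S ↔ ∃ i, g i = v)
    (h : ∀ i j, G.Adj (g i) (g j) ↔ H.Adj i j) :
    Nonempty (SimpleGraph.induce S G ≃g H) := by
  refine ⟨SimpleGraph.Iso.symm ⟨Equiv.ofBijective (fun i => (⟨g i, (hS _).2 ⟨i, rfl⟩⟩ : S)) ⟨?_, ?_⟩, ?_⟩⟩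
  · intro i j hij
    exact hg (Subtype.mk.inj hij)
  · rintro ⟨v, hv⟩
    obtain ⟨i, hi⟩ := (hS v).1 hv
    exact ⟨i, Subtype.ext hi⟩
  · intro i j
    exact h i j

lemma iso_of_fin {n : ℕ} (G : SimpleGraph V) (H : SimpleGraph (Fin n)) (S : Set V) (g : Fin n → V)
    (hS : ∀ v, v ∈ S ↔ ∃ i, g i = v)
    (h : ∀ i j, i < j → g i ≠ g j ∧ (G.Adj (g i) (g j) ↔ H.Adj i j)) :
    Nonempty (SimpleGraph.induce S G ≃g H) := by
  refine iso_of G H S g ?_ hS ?_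
  · intro i j hij
    rcases lt_trichotomy i j with h1 | h1 | h1
    · exact absurd hij (h i j h1).1
    · exact h1
    · exact absurd hij.symm (h j i h1).1
  · intro i j
    rcases lt_trichotomy i j with h1 | h1 | h1
    · exact (h i j h1).2
    · subst h1; simp
    · rw [G.adj_comm, H.adj_comm]; exact (h j i h1).2

lemma iso_path2 (G : SimpleGraph V) (S : Set V) (a b : V) (hS : ∀ v, v ∈ S ↔ v = a ∨ v = b)
    (hab : G.Adj a b) : Nonempty (SimpleGraph.induce S G ≃g SimpleGraph.pathGraph 2) := by
  apply iso_of_fin G _ S ![a, b]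
  · intro v; rw [hS]; simp [Fin.exists_fin_succ, eq_comm]
  · intro i j hij
    fin_cases i <;> fin_cases j <;>
      simp_all [SimpleGraph.pathGraph_adj, hab.ne]

lemma iso_path4 (G : SimpleGraph V) (S : Set V) (a b c d : V)
    (hS : ∀ v, v ∈ S ↔ v = a ∨ v = b ∨ v = c ∨ v = d)
    (hac : a ≠ c) (had : a ≠ d) (hbd : b ≠ d)
    (h1 : G.Adj a b) (h2 : G.Adj b c) (h3 : G.Adj c d)
    (n1 : ¬ G.Adj a c) (n2 : ¬ G.Adj a d) (n3 : ¬ G.Adj b d) :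
    Nonempty (SimpleGraph.induce S G ≃g SimpleGraph.pathGraph 4) := by
  apply iso_of_fin G _ S ![a, b, c, d]
  · intro v; rw [hS]; simp [Fin.exists_fin_succ, eq_comm]
  · have e1 := h1.ne
    have e2 := h2.ne
    have e3 := h3.ne
    intro i j hij
    fin_cases i <;> fin_cases j <;>
      simp_all [SimpleGraph.pathGraph_adj]

lemma iso_twoK2 (G : SimpleGraph V) (S : Set V) (a b c d : V)
    (hS : ∀ v, v ∈ S ↔ v = a ∨ v = b ∨ v = c ∨ v = d)
    (hac : a ≠ c) (had : a ≠ d) (hbc : b ≠ c) (hbd : b ≠ d)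
    (h1 : G.Adj a b) (h3 : G.Adj c d)
    (n1 : ¬ G.Adj a c) (n2 : ¬ G.Adj a d) (n3 : ¬ G.Adj b c) (n4 : ¬ G.Adj b d) :
    Nonempty (SimpleGraph.induce S G ≃g twoK2) := by
  apply iso_of_fin G _ S ![a, b, c, d]
  · intro v; rw [hS]; simp [Fin.exists_fin_succ, eq_comm]
  · have e1 := h1.ne
    have e3 := h3.ne
    intro i j hij
    fin_cases i <;> fin_cases j <;>
      simp_all [twoK2]

lemma iso_T0 (G : SimpleGraph V) (S : Set V) (x y a b c d : V)
    (hS : ∀ v, v ∈ S ↔ v = x ∨ v = y ∨ v = a ∨ v = b ∨ v = c ∨ v = d)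
    (hxc : x ≠ c) (hxd : x ≠ d) (hya : y ≠ a) (hyb : y ≠ b)
    (hab : a ≠ b) (hcd : c ≠ d)
    (hac : a ≠ c) (had : a ≠ d) (hbc : b ≠ c) (hbd : b ≠ d)
    (h1 : G.Adj x y) (h2 : G.Adj x a) (h3 : G.Adj x b) (h4 : G.Adj y c) (h5 : G.Adj y d)
    (m1 : ¬ G.Adj x c) (m2 : ¬ G.Adj x d) (m3 : ¬ G.Adj y a) (m4 : ¬ G.Adj y b)
    (m5 : ¬ G.Adj a b) (m6 : ¬ G.Adj c d)
    (n1 : ¬ G.Adj a c) (n2 : ¬ G.Adj a d) (n3 : ¬ G.Adj b c) (n4 : ¬ G.Adj b d) :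
    Nonempty (SimpleGraph.induce S G ≃g treeT0) := by
  apply iso_of_fin G _ S ![x, y, a, b, c, d]
  · intro v; rw [hS]; simp [Fin.exists_fin_succ, eq_comm]
  · have e1 := h1.ne
    have e2 := h2.ne
    have e3 := h3.ne
    have e4 := h4.ne
    have e5 := h5.ne
    intro i j hij
    fin_cases i <;> fin_cases j <;>
      first
      | (exfalso; revert hij; decide)
      | (simp [treeT0, *])

lemma iso_star (G : SimpleGraph V) (S : Set V) (x a b c : V)
    (hS : ∀ v, v ∈ S ↔ v = x ∨ v = a ∨ v = b ∨ v = c)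
    (hab : a ≠ b) (hac : a ≠ c) (hbc : b ≠ c)
    (h1 : G.Adj x a) (h2 : G.Adj x b) (h3 : G.Adj x c)
    (n1 : ¬ G.Adj a b) (n2 : ¬ G.Adj a c) (n3 : ¬ G.Adj b c) :
    Nonempty (SimpleGraph.induce S G ≃g completeBipartiteGraph (Fin 1) (Fin 3)) := by
  have e1 := h1.ne
  have e2 := h2.ne
  have e3 := h3.ne
  have n1' : ¬ G.Adj b a := fun h => n1 h.symm
  have n2' : ¬ G.Adj c a := fun h => n2 h.symm
  have n3' : ¬ G.Adj c b := fun h => n3 h.symm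
  apply iso_of G _ S (Sum.elim (fun _ => x) ![a, b, c])
  · rintro (i | i) (j | j) hij <;> fin_cases i <;> fin_cases j <;> simp_all
  · intro v; rw [hS]; simp [Fin.exists_fin_succ, eq_comm]
  · rintro (i | i) (j | j) <;> fin_cases i <;> fin_cases j <;>
      simp [completeBipartiteGraph_adj, *, h1.symm, h2.symm, h3.symm]

lemma struct {P : PlaneGraph V} (hP : IsFullerene P) (B : Fragment P)
    (W : Finset V) (hW : W = (edgeVerts B.edges).filter (fun v => deg B.edges v = 2)) :
    5 ≤ (edgeVerts B.edges).card ∧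
    (∀ v w, P.graph.Adj v w → s(v, w) ∉ B.edges → v ∈ edgeVerts B.edges → v ∈ W) ∧
    (∀ w ∈ W, ∃ u, P.graph.Adj w u ∧ s(w, u) ∉ B.edges ∧
      ∀ z, P.graph.Adj w z → s(w, z) ∉ B.edges → z = u) ∧
    ∃ m, W.card = 2 * m + (cut P (edgeVerts B.edges)).card := by
  have hsub : B.edges ⊆ ed P := by
    intro e he
    simp only [Fragment.edges, Finset.mem_sup, id] at he
    obtain ⟨f, hf, hef⟩ := he
    exact face_sub P (B.subFaces hf) hef
  have hfB : ∀ f ∈ B.inFaces, f ⊆ B.edges := fun f hf => Finset.le_sup (f := id) hf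
  have hdeg : ∀ v, deg B.edges v + deg (ed P \ B.edges) v = 3 := by
    intro v
    rw [← deg_ed hP v]
    unfold deg
    rw [← Finset.card_union_of_disjoint, ← Finset.filter_union, Finset.union_sdiff_of_subset hsub]
    exact Finset.disjoint_filter_filter Finset.disjoint_sdiff
  have hge : ∀ v ∈ edgeVerts B.edges, 2 ≤ deg B.edges v := by
    intro v hv
    obtain ⟨e, he, hve⟩ := mem_edgeVerts.1 hv
    simp only [Fragment.edges, Finset.mem_sup, id] at he
    obtain ⟨f, hf, hef⟩ := he
    have h1 := deg_face (B.subFaces hf) (v := v) (mem_edgeVerts.2 ⟨e, hef, hve⟩)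
    rw [← h1]
    exact Finset.card_le_card (Finset.filter_subset_filter _ (hfB f hf))
  have hD : ∀ v ∈ edgeVerts B.edges, deg (ed P \ B.edges) v = if v ∈ W then 1 else 0 := by
    intro v hv
    have h1 := hdeg v
    have h2 := hge v hv
    have h3 : v ∈ W ↔ deg B.edges v = 2 := by rw [hW]; simp [hv]
    split_ifs with h4
    · have := h3.1 h4; omega
    · have h6 : deg B.edges v ≠ 2 := fun h => h4 (h3.2 h)
      omega
  have hWV : W ⊆ edgeVerts B.edges := by rw [hW]; exact Finset.filter_subset _ _
  refine ⟨?_, ?_, ?_, ?_⟩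
  · obtain ⟨f, hf⟩ := B.nonempty
    have h1 := face_count (B.subFaces hf) Finset.univ
    rw [EIn_univ, cut_univ] at h1
    have h2 : f ∩ ed P = f := Finset.inter_eq_left.2 (face_sub P (B.subFaces hf))
    rw [h2] at h1
    simp only [Finset.univ_inter, Finset.inter_empty, Finset.card_empty] at h1
    have h3 := hP.faceSize f (B.subFaces hf)
    have h4 : edgeVerts f ⊆ edgeVerts B.edges := by
      intro v hv
      obtain ⟨e, he, hve⟩ := mem_edgeVerts.1 hv
      exact mem_edgeVerts.2 ⟨e, hfB f hf he, hve⟩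
    have := Finset.card_le_card h4
    omega
  · intro v w hvw hn hv
    by_contra h
    have h1 := hD v hv
    rw [if_neg h] at h1
    have : 0 < deg (ed P \ B.edges) v :=
      deg_pos.2 (mem_edgeVerts.2 ⟨s(v, w), by
        rw [Finset.mem_sdiff, mem_ed]; exact ⟨hvw, hn⟩, by simp⟩)
    omega
  · intro w hw
    have h1 := hD w (hWV hw)
    rw [if_pos hw, deg_eq_ncard P, Set.ncard_eq_one] at h1
    obtain ⟨u, hu⟩ := h1
    have key : ∀ z, (P.graph.Adj w z ∧ s(w, z) ∉ B.edges) ↔ z = u := by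
      intro z
      have := Set.ext_iff.1 hu z
      rw [Set.mem_ofPred_eq, Finset.mem_sdiff, mem_ed, Set.mem_singleton_iff] at this
      exact this
    have := (key u).2 rfl
    exact ⟨u, this.1, this.2, fun z h2 h3 => (key z).1 ⟨h2, h3⟩⟩
  · have h1 := sum_deg P (edgeVerts B.edges) (A := ed P \ B.edges) Finset.sdiff_subset
    rw [Finset.sum_congr rfl hD] at h1
    rw [← Finset.sum_filter, Finset.sum_const, smul_eq_mul, mul_one,
      Finset.filter_mem_eq_inter, Finset.inter_eq_right.2 hWV] at h1
    have h2 : (ed P \ B.edges) ∩ cut P (edgeVerts B.edges) = cut P (edgeVerts B.edges) := by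
      apply Finset.inter_eq_right.2
      intro e he
      rw [mem_cut] at he
      rw [Finset.mem_sdiff]
      refine ⟨he.1, fun h => ?_⟩
      obtain ⟨v, hv, hv'⟩ := he.2.2
      exact hv' (mem_edgeVerts.2 ⟨e, h, hv⟩)
    rw [h2] at h1
    exact ⟨_, h1⟩

set_option maxHeartbeats 800000 in
/-- The four possible shapes. -/
lemma shapes {P : PlaneGraph V} (hP : IsFullerene P) (B : Fragment P)
    (W : Finset V) (hW : W = (edgeVerts B.edges).filter (fun v => deg B.edges v = 2))
    (hpos : 0 < W.card) (hle : W.card ≤ 4)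
    (S : Set V) (hS : S = (((edgeVerts B.edges \ W : Finset V) : Set V))ᶜ) :
    (W.card = 2 ∧ Nonempty (SimpleGraph.induce S P.graph ≃g SimpleGraph.pathGraph 2)) ∨
    (W.card = 3 ∧
      Nonempty (SimpleGraph.induce S P.graph ≃g completeBipartiteGraph (Fin 1) (Fin 3))) ∨
    (W.card = 4 ∧
      (Nonempty (SimpleGraph.induce S P.graph ≃g twoK2) ∨
       Nonempty (SimpleGraph.induce S P.graph ≃g SimpleGraph.pathGraph 4) ∨
       Nonempty (SimpleGraph.induce S P.graph ≃g treeT0))) := by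
  obtain ⟨h5, hout, hpart, m, hm⟩ := struct hP B W hW
  have hWV : W ⊆ edgeVerts B.edges := by rw [hW]; exact Finset.filter_subset _ _
  have hSm : ∀ v, v ∈ S ↔ v ∉ edgeVerts B.edges ∨ v ∈ W := by
    intro v; rw [hS]; simp; clear * -; tauto
  have hnB : ∀ v w, w ∉ edgeVerts B.edges → s(v, w) ∉ B.edges := fun v w hw h =>
    hw (mem_edgeVerts.2 ⟨_, h, by simp⟩)
  clear hS hW
  generalize edgeVerts B.edges = Y at *
  generalize B.edges = E at *
  have hsm := small_cut hP (X := Y)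
  have hc3 := cut3 hP _ Y rfl
  have hc4 := cut4 hP _ Y rfl
  have hvc := vert_count hP Yᶜ
  rw [cut_compl] at hvc
  have hYne : Y ≠ ∅ := by rintro rfl; simp at h5
  -- neighbours of outside vertices
  have hnb : ∀ x, x ∉ Y → ∀ w, P.graph.Adj x w → w ∈ Y → w ∈ W := by
    intro x hx w hxw hw
    exact hout w x hxw.symm (hnB _ _ hx) hw
  have hnb3 : ∀ x, ∃ a b c, a ≠ b ∧ a ≠ c ∧ b ≠ c ∧ P.graph.Adj x a ∧ P.graph.Adj x b ∧
      P.graph.Adj x c := by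
    intro x
    obtain ⟨a, b, c, h1, h2, h3, h4⟩ := Set.ncard_eq_three.1 (hP.cubic x)
    have key : ∀ z, P.graph.Adj x z ↔ z = a ∨ z = b ∨ z = c := by
      intro z; have := Set.ext_iff.1 h4 z; simpa using this
    exact ⟨a, b, c, h1, h2, h3, (key a).2 (by simp), (key b).2 (by simp), (key c).2 (by simp)⟩
  have hd : (cut P Y).card = 0 ∨ (cut P Y).card = 3 ∨ (cut P Y).card = 4 := by
    by_cases h : (cut P Y).card ≤ 2
    · rcases hsm h with h1 | h1
      · exact absurd h1 hYne
      · left; rw [h1, cut_univ]; simp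
    · omega
  rcases hd with hd | hd | hd
  · -- no cut: everything is covered
    have hYu : Y = Finset.univ := (hsm (by omega)).resolve_left hYne
    subst hYu
    have hpw : ∀ w ∈ W, ∃ u ∈ W, P.graph.Adj w u ∧ s(w, u) ∉ E ∧
        ∀ z, P.graph.Adj w z → s(w, z) ∉ E → z = u := by
      intro w hw
      obtain ⟨u, h1, h2, h3⟩ := hpart w hw
      exact ⟨u, hout u w h1.symm (by rwa [Sym2.eq_swap]) (by simp), h1, h2, h3⟩
    have hcase : W.card = 2 ∨ W.card = 4 := by omega
    rcases hcase with hc | hc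
    · left
      refine ⟨hc, ?_⟩
      obtain ⟨a, b, hab, rfl⟩ := Finset.card_eq_two.1 hc
      obtain ⟨u, hu, h1, -, -⟩ := hpw a (by simp)
      have : u = b := by
        simp only [Finset.mem_insert, Finset.mem_singleton] at hu
        exact hu.resolve_left h1.ne.symm
      subst this
      exact iso_path2 _ S a u (by intro v; rw [hSm]; simp) h1
    · right; right
      refine ⟨hc, ?_⟩
      obtain ⟨a, ha⟩ := Finset.card_pos.1 hpos
      obtain ⟨b, hb, h1, h1', h1u⟩ := hpw a ha
      have hcard : ((W.erase a).erase b).card = 2 := by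
        rw [Finset.card_erase_of_mem, Finset.card_erase_of_mem ha, hc]
        simp [hb, h1.ne.symm]
      obtain ⟨c, d, hcd, he⟩ := Finset.card_eq_two.1 hcard
      have hmem : ∀ v, v ∈ W ↔ v = a ∨ v = b ∨ v = c ∨ v = d := by
        intro v
        have := Finset.ext_iff.1 he v
        simp only [Finset.mem_erase, Finset.mem_insert, Finset.mem_singleton] at this
        constructor
        · intro hv
          by_cases e1 : v = a
          · exact Or.inl e1
          by_cases e2 : v = b
          · exact Or.inr (Or.inl e2)
          exact Or.inr (Or.inr (this.1 ⟨e2, e1, hv⟩))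
        · rintro (rfl | rfl | h)
          · exact ha
          · exact hb
          · exact (this.2 h).2.2
      have hc' : c ∈ (W.erase a).erase b := by rw [he]; simp
      have hd' : d ∈ (W.erase a).erase b := by rw [he]; simp
      simp only [Finset.mem_erase] at hc' hd'
      obtain ⟨hcb, hca, hcW⟩ := hc'
      obtain ⟨hdb, hda, hdW⟩ := hd'
      obtain ⟨u, hu, h2, h2', -⟩ := hpw c hcW
      have hud : u = d := by
        rcases (hmem u).1 hu with rfl | rfl | rfl | rfl
        · exact absurd (h1u c h2.symm (by rwa [Sym2.eq_swap])) hcb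
        · obtain ⟨z, -, -, -, hz⟩ := hpw u hb
          have e1 := hz a h1.symm (by rwa [Sym2.eq_swap])
          have e2 := hz c h2.symm (by rwa [Sym2.eq_swap])
          exact absurd (e2.trans e1.symm) hca
        · exact absurd h2 (by simp)
        · rfl
      subst hud
      have hSv : ∀ v, v ∈ S ↔ v = a ∨ v = b ∨ v = c ∨ v = u := by
        intro v; rw [hSm, ← hmem]; simp
      have t := fun x y z => no_tri' hP (a := x) (b := y) (c := z)
      have q := fun x y z w => no_quad' hP (a := x) (b := y) (c := z) (d := w)
      by_cases k1 : P.graph.Adj a c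
      · right; left
        refine iso_path4 _ S b a c u ?_ hcb.symm hdb.symm hda.symm h1.symm k1 h2 ?_ ?_ ?_
        · intro v; rw [hSv]; clear * -; tauto
        · exact fun h => t a b c h1 h k1
        · exact fun h => q a b u c hda.symm hcb.symm h1 h h2.symm k1.symm
        · exact fun h => t a c u k1 h2 h
      by_cases k2 : P.graph.Adj a u
      · right; left
        refine iso_path4 _ S b a u c ?_ hdb.symm hcb.symm hca.symm h1.symm k2 h2.symm ?_ ?_ k1
        · intro v; rw [hSv]; clear * -; tauto
        · exact fun h => t a b u h1 h k2
        · exact fun h => q a b c u hca.symm hdb.symm h1 h h2 k2.symm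
      by_cases k3 : P.graph.Adj b c
      · right; left
        refine iso_path4 _ S a b c u hSv hca.symm hda.symm hdb.symm h1 k3 h2 k1 k2 ?_
        exact fun h => t b c u k3 h2 h
      by_cases k4 : P.graph.Adj b u
      · right; left
        refine iso_path4 _ S a b u c ?_ hda.symm hca.symm hcb.symm h1 k4 h2.symm k2 k1 k3
        intro v; rw [hSv]; clear * -; tauto
      left
      exact iso_twoK2 _ S a b c u hSv hca.symm hda.symm hcb.symm hdb.symm h1 h2 k1 k2 k3 k4
  · right; left
    have hc : W.card = 3 := by omega
    refine ⟨hc, ?_⟩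
    have hX : Yᶜ.card = 1 := (hc3 hd).resolve_left (by omega)
    obtain ⟨x, hx⟩ := Finset.card_eq_one.1 hX
    have hY : ∀ v, v ∉ Y ↔ v = x := by
      intro v; have := Finset.ext_iff.1 hx v; simpa using this
    obtain ⟨a, b, c, hab, hac, hbc, h1, h2, h3⟩ := hnb3 x
    have hin : ∀ w, P.graph.Adj x w → w ∈ W := by
      intro w hw
      refine hnb x ((hY x).2 rfl) w hw ?_
      by_contra h
      exact hw.ne ((hY w).1 h).symm
    have hWe : {a, b, c} = W := by
      apply Finset.eq_of_subset_of_card_le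
      · intro v hv
        simp only [Finset.mem_insert, Finset.mem_singleton] at hv
        rcases hv with rfl | rfl | rfl
        · exact hin _ h1
        · exact hin _ h2
        · exact hin _ h3
      · rw [hc, Finset.card_eq_three.2 ⟨a, b, c, hab, hac, hbc, rfl⟩]
    have t := fun y z => no_tri' hP (a := x) (b := y) (c := z)
    refine iso_star _ S x a b c ?_ hab hac hbc h1 h2 h3 ?_ ?_ ?_
    · intro v; rw [hSm, hY, ← hWe]; simp
    · exact fun h => t a b h1 h h2
    · exact fun h => t a c h1 h h3
    · exact fun h => t b c h2 h h3
  · right; right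
    have hc : W.card = 4 := by omega
    refine ⟨hc, Or.inr (Or.inr ?_)⟩
    have hX : Yᶜ.card = 2 := (hc4 hd).resolve_left (by omega)
    obtain ⟨x, y, hxy, hx⟩ := Finset.card_eq_two.1 hX
    have hY : ∀ v, v ∉ Y ↔ v = x ∨ v = y := by
      intro v; have := Finset.ext_iff.1 hx v; simpa using this
    have hA : P.graph.Adj x y := by
      have h1 : 0 < (EIn P Yᶜ).card := by omega
      obtain ⟨e, he⟩ := Finset.card_pos.1 h1
      rw [mem_EIn, mem_ed, hx] at he
      obtain ⟨he1, he2⟩ := he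
      induction e with
      | h p q =>
        have hp := he2 p (by simp)
        have hq := he2 q (by simp)
        have hpq : P.graph.Adj p q := he1
        simp only [Finset.mem_insert, Finset.mem_singleton] at hp hq
        rcases hp with rfl | rfl <;> rcases hq with rfl | rfl
        · exact absurd hpq (by simp)
        · exact hpq
        · exact hpq.symm
        · exact absurd hpq (by simp)
    have two : ∀ x y, P.graph.Adj x y → ∃ a b, a ≠ b ∧ a ≠ y ∧ b ≠ y ∧ P.graph.Adj x a ∧
        P.graph.Adj x b := by
      intro x y hxy
      obtain ⟨a, b, c, hab, hac, hbc, h1, h2, h3⟩ := hnb3 x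
      by_cases e1 : a = y
      · exact ⟨b, c, hbc, fun h => hab (e1.trans h.symm), fun h => hac (e1.trans h.symm), h2, h3⟩
      · by_cases e2 : b = y
        · exact ⟨a, c, hac, e1, fun h => hbc (e2.trans h.symm), h1, h3⟩
        · exact ⟨a, b, hab, e1, e2, h1, h2⟩
    obtain ⟨a, b, hab, hay, hby, h1, h2⟩ := two x y hA
    obtain ⟨c, d, hcd, hcx, hdx, h3, h4⟩ := two y x hA.symm
    have hxY := (hY x).2 (Or.inl rfl)
    have hyY := (hY y).2 (Or.inr rfl)
    have hinx : ∀ w, w ≠ y → P.graph.Adj x w → w ∈ W := by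
      intro w hw hxw
      refine hnb x hxY w hxw ?_
      by_contra h
      exact ((hY w).1 h).elim hxw.ne.symm hw
    have hiny : ∀ w, w ≠ x → P.graph.Adj y w → w ∈ W := by
      intro w hw hxw
      refine hnb y hyY w hxw ?_
      by_contra h
      exact ((hY w).1 h).elim hw hxw.ne.symm
    have t := fun x y z => no_tri' hP (a := x) (b := y) (c := z)
    have q := fun x y z w => no_quad' hP (a := x) (b := y) (c := z) (d := w)
    have hac : a ≠ c := by rintro rfl; exact t x y a hA h3 h1
    have had : a ≠ d := by rintro rfl; exact t x y a hA h4 h1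
    have hbc : b ≠ c := by rintro rfl; exact t x y b hA h3 h2
    have hbd : b ≠ d := by rintro rfl; exact t x y b hA h4 h2
    have hWe : {a, b, c, d} = W := by
      apply Finset.eq_of_subset_of_card_le
      · intro v hv
        simp only [Finset.mem_insert, Finset.mem_singleton] at hv
        rcases hv with rfl | rfl | rfl | rfl
        · exact hinx _ hay h1
        · exact hinx _ hby h2
        · exact hiny _ hcx h3
        · exact hiny _ hdx h4
      · rw [hc]
        simp [hab, hac, had, hbc, hbd, hcd]
    refine iso_T0 _ S x y a b c d ?_ hcx.symm hdx.symm hay.symm hby.symm hab hcd hac had hbc hbd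
      hA h1 h2 h3 h4 ?_ ?_ ?_ ?_ ?_ ?_ ?_ ?_ ?_ ?_
    · intro v; rw [hSm, hY, ← hWe]
      simp only [Finset.mem_insert, Finset.mem_singleton]; clear * -; tauto
    · exact fun h => t x y c hA h3 h
    · exact fun h => t x y d hA h4 h
    · exact fun h => t x y a hA h h1
    · exact fun h => t x y b hA h h2
    · exact fun h => t x a b h1 h h2
    · exact fun h => t y c d h3 h h4
    · exact fun h => q x a c y hcx.symm hay h1 h h3.symm hA.symm
    · exact fun h => q x a d y hdx.symm hay h1 h h4.symm hA.symm
    · exact fun h => q x b c y hcx.symm hby h2 h h3.symm hA.symm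
    · exact fun h => q x b d y hdx.symm hby h2 h h4.symm hA.symm

/-- Lemma 2.2. Let `B` be a fragment of a fullerene graph `F` and `W`
the set of 2-degree vertices of `B`, with `0 < |W| ≤ 4`. Then `T = F − (V(B) ∖ W)` is a
forest; it is `K_2` if `|W| = 2`, `K_{1,3}` if `|W| = 3`, and the disjoint union of two
`K_2`'s, a path of length 3, or the tree `T_0` if `|W| = 4`. -/
theorem statement_0 (P : PlaneGraph V) (hP : IsFullerene P) (B : Fragment P)
    (W : Finset V) (hW : W = (edgeVerts B.edges).filter (fun v => deg B.edges v = 2))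
    (hpos : 0 < W.card) (hle : W.card ≤ 4)
    (S : Set V) (hS : S = (((edgeVerts B.edges \ W : Finset V) : Set V))ᶜ) :
    (SimpleGraph.induce S P.graph).IsAcyclic ∧
    (W.card = 2 →
      Nonempty (SimpleGraph.induce S P.graph ≃g SimpleGraph.pathGraph 2)) ∧
    (W.card = 3 →
      Nonempty (SimpleGraph.induce S P.graph ≃g completeBipartiteGraph (Fin 1) (Fin 3))) ∧
    (W.card = 4 →
      (Nonempty (SimpleGraph.induce S P.graph ≃g twoK2) ∨
       Nonempty (SimpleGraph.induce S P.graph ≃g SimpleGraph.pathGraph 4) ∨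
       Nonempty (SimpleGraph.induce S P.graph ≃g treeT0))) := by
  have hsh := shapes hP B W hW hpos hle S hS
  refine ⟨?_, ?_, ?_, ?_⟩
  · rcases hsh with ⟨-, ⟨h⟩⟩ | ⟨-, ⟨h⟩⟩ | ⟨-, h | h | h⟩
    · exact h.isAcyclic_iff.2 (ac_path 2)
    · exact h.isAcyclic_iff.2 ac_star
    · exact h.some.isAcyclic_iff.2 ac_twoK2
    · exact h.some.isAcyclic_iff.2 (ac_path 4)
    · exact h.some.isAcyclic_iff.2 ac_T0
  · intro h
    rcases hsh with h1 | h1 | h1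
    · exact h1.2
    · omega
    · omega
  · intro h
    rcases hsh with h1 | h1 | h1
    · omega
    · exact h1.2
    · omega
  · intro h
    rcases hsh with h1 | h1 | h1
    · omega
    · omega
    · exact h1.2

end FG
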